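/- arXiv:2303.10814 — 8 statements merged into one kernel-verified Lean document; each statement's English description precedes it below -/
import Mathlib

section
/- For all n, m ≥ 0, the set of orbits of the diagonal action of H = (ℝ ≃o ℝ) on ℝ^{(n)} × ℝ^{(m)} is in bijection with the set of (n,m)-Delannoy paths; in particular, the number of orbits is the Delannoy number D(n,m). -/
/-- A Delannoy step: `(1,0)`, `(0,1)` or `(1,1)`. -/
def IsDelannoyStep (p : ℕ × ℕ) : Prop :=
  p = (1, 0) ∨ p = (0, 1) ∨ p = (1, 1)

/-- An `(n,m)`-Delannoy path: a list of Delannoy steps whose sum is `(n,m)`. -/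
def DelannoyPath (n m : ℕ) : Type :=
  {s : List (ℕ × ℕ) // (∀ p ∈ s, IsDelannoyStep p) ∧ s.sum = (n, m)}

/-- The Delannoy number `D(n,m)`: the number of `(n,m)`-Delannoy paths. -/
noncomputable def delannoyNumber (n m : ℕ) : ℕ :=
  Nat.card (DelannoyPath n m)

/-- `ℝ^{(n)} × ℝ^{(m)}`: pairs of strictly increasing tuples. -/
def OrderedPair (n m : ℕ) : Type :=
  {x : Fin n → ℝ // StrictMono x} × {y : Fin m → ℝ // StrictMono y}

/-- Two pairs are related if some order-preserving bijection of `ℝ` carries one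
to the other (diagonal action on both factors simultaneously). -/
def HRel (n m : ℕ) (p q : OrderedPair n m) : Prop :=
  ∃ f : ℝ ≃o ℝ, (∀ k, f (p.1.1 k) = q.1.1 k) ∧ (∀ k, f (p.2.1 k) = q.2.1 k)

/-- The order automorphism of `ℝ` fixing `(-∞, p]` and scaling `[p, ∞)` from `p` by `c`. -/
noncomputable def stretchAbove (p c : ℝ) (hc : 0 < c) : ℝ ≃o ℝ :=
  have mono : ∀ d : ℝ, 0 < d → StrictMono fun t : ℝ => if t ≤ p then t else p + d * (t - p) := by
    intro d hd s t hst
    dsimp only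
    split_ifs with hs ht ht
    · exact hst
    · have := mul_pos hd (sub_pos.2 (not_le.1 ht))
      linarith
    · linarith
    · have := mul_lt_mul_of_pos_left (sub_lt_sub_right hst p) hd
      linarith
  StrictMono.orderIsoOfRightInverse _ (mono c hc)
    (fun t => if t ≤ p then t else p + c⁻¹ * (t - p)) (by
      intro t
      dsimp only
      by_cases ht : t ≤ p
      · simp [ht]
      · have := mul_pos (inv_pos.2 hc) (sub_pos.2 (not_le.1 ht))
        have h : ¬ p + c⁻¹ * (t - p) ≤ p := by linarith
        rw [if_neg ht, if_neg h]
        field_simp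
        ring)

theorem stretchAbove_of_le {p c t : ℝ} (hc : 0 < c) (ht : t ≤ p) : stretchAbove p c hc t = t :=
  if_pos ht

theorem stretchAbove_of_lt {p c t : ℝ} (hc : 0 < c) (ht : p < t) :
    stretchAbove p c hc t = p + c * (t - p) :=
  if_neg ht.not_ge

/-- The group `ℝ ≃o ℝ` acts transitively on strictly increasing `k`-tuples. -/
theorem StrictMono.exists_orderIso_real_apply_eq {k : ℕ} {x y : Fin k → ℝ} (hx : StrictMono x)
    (hy : StrictMono y) : ∃ f : ℝ ≃o ℝ, ∀ i, f (x i) = y i := by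
  induction k with
  | zero => exact ⟨OrderIso.refl ℝ, fun i => i.elim0⟩
  | succ k ih =>
    obtain ⟨f, hf⟩ := ih (hx.comp Fin.strictMono_castSucc) (hy.comp Fin.strictMono_castSucc)
    simp only [Function.comp_apply] at hf
    rcases k with _ | k
    · refine ⟨OrderIso.addRight (y 0 - x 0), fun i => ?_⟩
      rw [Fin.fin_one_eq_zero i]
      simp
    · set p := y (Fin.last k).castSucc with hp
      have hpx : p < f (x (Fin.last (k + 1))) := by
        rw [hp, ← hf, f.lt_iff_lt]
        exact hx (Fin.castSucc_lt_last _)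
      have hpy : p < y (Fin.last (k + 1)) := hy (Fin.castSucc_lt_last _)
      have hc := div_pos (sub_pos.2 hpy) (sub_pos.2 hpx)
      refine ⟨f.trans (stretchAbove p _ hc), fun i => ?_⟩
      rw [OrderIso.trans_apply]
      induction i using Fin.lastCases with
      | last =>
        rw [stretchAbove_of_lt hc hpx, div_mul_cancel₀ _ (sub_pos.2 hpx).ne']
        ring
      | cast i =>
        rw [hf, stretchAbove_of_le hc]
        exact hy.monotone (Fin.castSucc_le_castSucc_iff.2 (Fin.le_last i))

/-- The Delannoy step recording to which of `A` and `B` the point `t` belongs. -/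
noncomputable def membershipStep (A B : Finset ℝ) (t : ℝ) : ℕ × ℕ :=
  (if t ∈ A then 1 else 0, if t ∈ B then 1 else 0)

theorem membershipStep_eq_iff {A B A' B' : Finset ℝ} {s t : ℝ} :
    membershipStep A B s = membershipStep A' B' t ↔ (s ∈ A ↔ t ∈ A') ∧ (s ∈ B ↔ t ∈ B') := by
  unfold membershipStep
  by_cases s ∈ A <;> by_cases s ∈ B <;> by_cases t ∈ A' <;> by_cases t ∈ B' <;> simp [*]

/-- The list of membership steps of the points of `A ∪ B`, in increasing order. -/
noncomputable def mergeWord (A B : Finset ℝ) : List (ℕ × ℕ) :=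
  (A ∪ B).sort.map (membershipStep A B)

theorem isDelannoyStep_of_mem_mergeWord {A B : Finset ℝ} {p : ℕ × ℕ} (hp : p ∈ mergeWord A B) :
    IsDelannoyStep p := by
  obtain ⟨t, ht, rfl⟩ := List.mem_map.1 hp
  rw [Finset.mem_sort, Finset.mem_union] at ht
  unfold IsDelannoyStep membershipStep
  by_cases t ∈ A <;> by_cases t ∈ B <;> simp_all

theorem sum_mergeWord (A B : Finset ℝ) : (mergeWord A B).sum = (A.card, B.card) := by
  have h : (mergeWord A B).sum = ∑ t ∈ A ∪ B, membershipStep A B t := by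
    rw [mergeWord, ← List.sum_toFinset _ (Finset.sort_nodup _ _), Finset.sort_toFinset]
  rw [h]
  ext <;> simp [membershipStep, Prod.fst_sum, Prod.snd_sum, Finset.union_inter_cancel_left,
    Finset.union_inter_cancel_right]

theorem mergeWord_map (f : ℝ ≃o ℝ) (A B : Finset ℝ) :
    mergeWord (A.map f.toEquiv.toEmbedding) (B.map f.toEquiv.toEmbedding) = mergeWord A B := by
  unfold mergeWord
  rw [← Finset.map_union, ← Finset.map_sort (r := (· ≤ ·)) _ _ _ (by simp), List.map_map]
  exact List.map_congr_left fun t _ => membershipStep_eq_iff.2 (by simp)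

theorem exists_orderIso_map_eq_of_mergeWord_eq {A B A' B' : Finset ℝ}
    (h : mergeWord A B = mergeWord A' B') :
    ∃ f : ℝ ≃o ℝ, A.map f.toEquiv.toEmbedding = A' ∧ B.map f.toEquiv.toEmbedding = B' := by
  have hcard : (A' ∪ B').card = (A ∪ B).card := by
    simpa [mergeWord] using (congrArg List.length h).symm
  obtain ⟨f, hf⟩ := ((A ∪ B).orderEmbOfFin rfl).strictMono.exists_orderIso_real_apply_eq
    ((A' ∪ B').orderEmbOfFin hcard).strictMono
  have hmap : (A ∪ B).map f.toEquiv.toEmbedding = A' ∪ B' := by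
    rw [← Finset.map_orderEmbOfFin_univ (A ∪ B) rfl, ← Finset.map_orderEmbOfFin_univ _ hcard,
      Finset.map_map]
    congr 1
    ext i
    exact hf i
  unfold mergeWord at h
  rw [← hmap, ← Finset.map_sort (r := (· ≤ ·)) _ _ _ (by simp), List.map_map,
    List.map_inj_left] at h
  have hmem : ∀ t ∈ A ∪ B, (t ∈ A ↔ f t ∈ A') ∧ (t ∈ B ↔ f t ∈ B') := fun t ht =>
    membershipStep_eq_iff.1 (h t ((Finset.mem_sort _).2 ht))
  have hmem' : ∀ t, f t ∈ A' ∪ B' → t ∈ A ∪ B := fun t ht => by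
    rw [← hmap] at ht
    simpa using ht
  refine ⟨f, Finset.ext (f.surjective.forall.2 fun t => ?_),
    Finset.ext (f.surjective.forall.2 fun t => ?_)⟩
  · have : f t ∈ A.map f.toEquiv.toEmbedding ↔ t ∈ A := by simp
    rw [this]
    exact ⟨fun ht => (hmem t (Finset.mem_union_left _ ht)).1.1 ht,
      fun ht => (hmem t (hmem' t (Finset.mem_union_left _ ht))).1.2 ht⟩
  · have : f t ∈ B.map f.toEquiv.toEmbedding ↔ t ∈ B := by simp
    rw [this]
    exact ⟨fun ht => (hmem t (Finset.mem_union_right _ ht)).2.1 ht,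
      fun ht => (hmem t (hmem' t (Finset.mem_union_right _ ht))).2.2 ht⟩

theorem exists_mergeWord_eq {s : List (ℕ × ℕ)} (hs : ∀ p ∈ s, IsDelannoyStep p) :
    ∃ A B : Finset ℝ, mergeWord A B = s := by
  let e : Fin s.length ↪ ℝ := ⟨fun i => (i : ℕ), fun i j h => Fin.ext (Nat.cast_injective h)⟩
  let A := (Finset.univ.filter fun i => (s.get i).1 = 1).map e
  let B := (Finset.univ.filter fun i => (s.get i).2 = 1).map e
  have hstep : ∀ i, IsDelannoyStep (s.get i) := fun i => hs _ (List.get_mem s i)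
  have hunion : A ∪ B = Finset.univ.map e := by
    rw [← Finset.map_union, ← Finset.filter_or, Finset.filter_true_of_mem]
    intro i _
    rcases hstep i with h | h | h <;> rw [h] <;> simp
  have hA : ∀ i, e i ∈ A ↔ (s.get i).1 = 1 := fun i => by simp [A]
  have hB : ∀ i, e i ∈ B ↔ (s.get i).2 = 1 := fun i => by simp [B]
  refine ⟨A, B, ?_⟩
  rw [mergeWord, hunion, ← Finset.map_sort (r := (· ≤ ·)) _ _ _ (fun _ _ _ _ => Nat.cast_le.symm), Fin.sort_univ,
    List.map_map]
  conv_rhs => rw [← List.map_get_finRange s]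
  refine List.map_congr_left fun i _ => ?_
  simp only [Function.comp_apply, membershipStep, hA, hB]
  rcases hstep i with h | h | h <;> rw [h] <;> rfl

/-- The finite set of entries of a strictly increasing tuple. -/
def StrictMono.entries {k : ℕ} {x : Fin k → ℝ} (hx : StrictMono x) : Finset ℝ :=
  Finset.univ.map ⟨x, hx.injective⟩

theorem StrictMono.card_entries {k : ℕ} {x : Fin k → ℝ} (hx : StrictMono x) :
    hx.entries.card = k := by
  simp [StrictMono.entries]

theorem StrictMono.map_entries_eq_iff {k : ℕ} {x y : Fin k → ℝ} (hx : StrictMono x)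
    (hy : StrictMono y) (f : ℝ ≃o ℝ) :
    hx.entries.map f.toEquiv.toEmbedding = hy.entries ↔ ∀ i, f (x i) = y i := by
  have h := (f.strictMono.comp hx).range_inj hy
  rw [funext_iff] at h
  refine Iff.trans ?_ h
  rw [← Finset.coe_inj]
  simp [StrictMono.entries, Set.range_comp]

theorem Finset.exists_strictMono_entries_eq {k : ℕ} {A : Finset ℝ} (hA : A.card = k) :
    ∃ (x : Fin k → ℝ) (hx : StrictMono x), hx.entries = A :=
  ⟨_, (A.orderEmbOfFin hA).strictMono, A.map_orderEmbOfFin_univ hA⟩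

/-- The Delannoy path of a pair of strictly increasing tuples. -/
noncomputable def OrderedPair.delannoyPath {n m : ℕ} (p : OrderedPair n m) : DelannoyPath n m :=
  ⟨mergeWord p.1.2.entries p.2.2.entries, fun _ => isDelannoyStep_of_mem_mergeWord, by
    rw [sum_mergeWord, StrictMono.card_entries, StrictMono.card_entries]⟩

theorem OrderedPair.delannoyPath_eq_iff {n m : ℕ} {p q : OrderedPair n m} :
    p.delannoyPath = q.delannoyPath ↔ HRel n m p q := by
  have h : HRel n m p q ↔ ∃ f : ℝ ≃o ℝ,
      p.1.2.entries.map f.toEquiv.toEmbedding = q.1.2.entries ∧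
        p.2.2.entries.map f.toEquiv.toEmbedding = q.2.2.entries := by
    simp only [StrictMono.map_entries_eq_iff, HRel]
  rw [h]
  refine ⟨fun h => exists_orderIso_map_eq_of_mergeWord_eq (congrArg Subtype.val h), ?_⟩
  rintro ⟨f, hA, hB⟩
  apply Subtype.ext
  change mergeWord _ _ = mergeWord _ _
  rw [← hA, ← hB, mergeWord_map]

theorem OrderedPair.delannoyPath_surjective (n m : ℕ) :
    Function.Surjective (OrderedPair.delannoyPath (n := n) (m := m)) := by
  rintro ⟨s, hs, hsum⟩
  obtain ⟨A, B, rfl⟩ := exists_mergeWord_eq hs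
  rw [sum_mergeWord, Prod.mk.injEq] at hsum
  obtain ⟨x, hx, rfl⟩ := Finset.exists_strictMono_entries_eq hsum.1
  obtain ⟨y, hy, rfl⟩ := Finset.exists_strictMono_entries_eq hsum.2
  exact ⟨(⟨x, hx⟩, ⟨y, hy⟩), rfl⟩

/-- Orbits of ordered pairs correspond to Delannoy paths. -/
noncomputable def orbitEquivDelannoyPath (n m : ℕ) : Quot (HRel n m) ≃ DelannoyPath n m :=
  Equiv.ofBijective
    (Quot.lift OrderedPair.delannoyPath fun _ _ => OrderedPair.delannoyPath_eq_iff.2) <| by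
    constructor
    · rintro ⟨p⟩ ⟨q⟩ h
      exact Quot.sound (OrderedPair.delannoyPath_eq_iff.1 h)
    · exact Quot.surjective_lift _ |>.2 (OrderedPair.delannoyPath_surjective n m)

/-- The set of orbits of `H = (ℝ ≃o ℝ)` acting diagonally on
`ℝ^{(n)} × ℝ^{(m)}` is in bijection with the set of `(n,m)`-Delannoy paths;
in particular the number of orbits is the Delannoy number `D(n,m)`. -/
theorem orbits_equiv_delannoyPaths (n m : ℕ) :
    Nonempty (Quot (HRel n m) ≃ DelannoyPath n m) ∧
      Nat.card (Quot (HRel n m)) = delannoyNumber n m := by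
  exact ⟨⟨orbitEquivDelannoyPath n m⟩, Nat.card_congr (orbitEquivDelannoyPath n m)⟩
end

section
/- For all n, m ≥ 1, the set of orbits of the diagonal action of G on S^{{n}} × S^{{m}} is in bijection with the set of (n,m)-Delannoy loops; in particular, the number of orbits is the circular Delannoy number C(n,m). Moreover, the bijection may be chosen equivariantly for ℤ/n × ℤ/m: cyclically shifting the first tuple by one position corresponds to translating the basepoint of the loop by (1,0) ∈ (ZMod n) × (ZMod m), and cyclically shifting the second tuple by one position corresponds to translating by (0,1) (for an appropriate choice of direction of the cyclic shifts). -/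
/-- The circle `S = ℝ/ℤ`. -/
abbrev Circle' : Type := AddCircle (1 : ℝ)

/-- `y` lies strictly between `x` and `z` in the cyclic order on the circle:
there are lifts `x̃ < ỹ < z̃ < x̃ + 1`. -/
def Sbtw' (x y z : Circle') : Prop :=
  ∃ a b c : ℝ, (a : Circle') = x ∧ (b : Circle') = y ∧ (c : Circle') = z ∧
    a < b ∧ b < c ∧ c < a + 1

/-- A bijection of the circle preserves the cyclic order. -/
def PreservesCyclicOrder (g : Equiv.Perm Circle') : Prop :=
  ∀ x y z : Circle', Sbtw' x y z ↔ Sbtw' (g x) (g y) (g z)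

/-- Membership in `S^{{n}}`: the tuple admits lifts `t 0 < t 1 < ⋯ < t (n-1) < t 0 + 1`. -/
def CyclicallyOrdered {n : ℕ} (x : Fin n → Circle') : Prop :=
  ∃ t : Fin n → ℝ, (∀ i, (t i : Circle') = x i) ∧ StrictMono t ∧ ∀ i j, t i < t j + 1

/-- A based `(n,m)`-loop: a basepoint `v : ZMod n × ZMod m` together with a list of
Delannoy steps whose sum (in `ℕ × ℕ`) is `(n,m)`. -/
def BasedLoop (n m : ℕ) : Type :=
  {b : (ZMod n × ZMod m) × List (ℕ × ℕ) //
    (∀ p ∈ b.2, IsDelannoyStep p) ∧ b.2.sum = (n, m)}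

/-- One-step rotation of based loops: `(v, s₀ :: L) ∼ (v + s̄₀, L ++ [s₀])`,
where `s̄₀` is the image of `s₀` in `ZMod n × ZMod m`. -/
def LoopRot (n m : ℕ) (b₁ b₂ : BasedLoop n m) : Prop :=
  ∃ (v : ZMod n × ZMod m) (s₀ : ℕ × ℕ) (L : List (ℕ × ℕ)),
    b₁.1 = (v, s₀ :: L) ∧
    b₂.1 = (v + ((s₀.1 : ZMod n), (s₀.2 : ZMod m)), L ++ [s₀])

/-- An `(n,m)`-Delannoy loop: an equivalence class of based `(n,m)`-loops under
the equivalence relation generated by rotation. -/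
def DelannoyLoop (n m : ℕ) : Type :=
  Quot (LoopRot n m)

/-- The circular Delannoy number `C(n,m)`: the number of `(n,m)`-Delannoy loops. -/
noncomputable def circularDelannoy (n m : ℕ) : ℕ :=
  Nat.card (DelannoyLoop n m)

/-- Translation of a based loop by `(c,d) ∈ ZMod n × ZMod m`. -/
def BasedLoop.translate {n m : ℕ} (c : ZMod n) (d : ZMod m)
    (b : BasedLoop n m) : BasedLoop n m :=
  ⟨((b.1.1.1 + c, b.1.1.2 + d), b.1.2), b.2⟩

/-- A point of `S^{{n}} × S^{{m}}`. -/
def CyclicPair (n m : ℕ) : Type :=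
  {x : Fin n → Circle' // CyclicallyOrdered x} × {y : Fin m → Circle' // CyclicallyOrdered y}

/-- Two points of `S^{{n}} × S^{{m}}` are in the same `G`-orbit: some
cyclic-order-preserving bijection of the circle carries one to the other
(acting diagonally on both factors simultaneously). -/
def GRel (n m : ℕ) (p q : CyclicPair n m) : Prop :=
  ∃ g : Equiv.Perm Circle', PreservesCyclicOrder g ∧
    (∀ k, g (p.1.1 k) = q.1.1 k) ∧ (∀ k, g (p.2.1 k) = q.2.1 k)

/-- A strictly increasing bi-infinite real sequence advancing by `1` every `N` terms. -/
structure IsPeriodicLift (N : ℕ) (U : ℤ → ℝ) : Prop where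
  strictMono : StrictMono U
  add_period : ∀ i, U (i + N) = U i + 1

/-- A tuple indexed by `Fin n`, regarded as indexed by `ZMod n`. -/
def zmodIndex {n : ℕ} [NeZero n] (x : Fin n → Circle') (z : ZMod n) : Circle' :=
  x ⟨z.val, z.val_lt⟩

theorem zmodIndex_natCast {n : ℕ} [NeZero n] (x : Fin n → Circle') {i : ℕ} (hi : i < n) :
    zmodIndex x (i : ZMod n) = x ⟨i, hi⟩ := by
  simp only [zmodIndex, ZMod.val_natCast, Nat.mod_eq_of_lt hi]

theorem zmodIndex_fin {n : ℕ} [NeZero n] (x : Fin n → Circle') (i : Fin n) :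
    zmodIndex x ((i : ℕ) : ZMod n) = x i :=
  zmodIndex_natCast x i.2

theorem zmodIndex_add_one {n : ℕ} [NeZero n] {x x' : Fin n → Circle'}
    (h : ∀ k, x' k = x (k - 1)) (z : ZMod n) : zmodIndex x' (z + 1) = zmodIndex x z := by
  obtain _ | n := n
  · exact absurd rfl (NeZero.ne 0)
  · refine (h _).trans (congrArg x ?_)
    exact add_sub_cancel_right (G := Fin (n + 1)) z 1

theorem coe_eq_coe_iff {a b : ℝ} : (a : Circle') = (b : Circle') ↔ ∃ k : ℤ, b = a + k := by
  rw [eq_comm, ← sub_eq_zero, ← AddCircle.coe_sub, AddCircle.coe_eq_zero_iff]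
  simp only [zsmul_eq_mul, mul_one, eq_sub_iff_add_eq', eq_comm (b := b)]

theorem coe_add_intCast (a : ℝ) (k : ℤ) : ((a + k : ℝ) : Circle') = (a : Circle') :=
  (coe_eq_coe_iff.2 ⟨k, rfl⟩).symm

theorem coe_injOn_Ico (t : ℝ) : Set.InjOn ((↑) : ℝ → Circle') (Set.Ico t (t + 1)) :=
  fun _ ha _ hb => (AddCircle.coe_eq_coe_iff_of_mem_Ico ha hb).1

theorem exists_mem_Ico_coe_eq (t : ℝ) (x : Circle') :
    ∃ a ∈ Set.Ico t (t + 1), (a : Circle') = x :=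
  ⟨AddCircle.equivIco 1 t x, (AddCircle.equivIco 1 t x).2, AddCircle.coe_equivIco⟩

namespace IsPeriodicLift

variable {N : ℕ} {U : ℤ → ℝ}

theorem pos (h : IsPeriodicLift N U) : 0 < N := by
  rcases Nat.eq_zero_or_pos N with rfl | hN
  · simpa using h.add_period 0
  · exact hN

theorem comp_add (h : IsPeriodicLift N U) (r : ℤ) : IsPeriodicLift N fun i => U (i + r) where
  strictMono i j hij := h.strictMono (by simpa using hij)
  add_period i := by rw [← h.add_period, add_right_comm]

theorem add_const (h : IsPeriodicLift N U) (c : ℝ) : IsPeriodicLift N fun i => U i + c where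
  strictMono i j hij := by simpa using h.strictMono hij
  add_period i := by rw [h.add_period, add_right_comm]

theorem cyclicallyOrdered (h : IsPeriodicLift N U) :
    CyclicallyOrdered fun k : Fin N => (U k : Circle') := by
  refine ⟨fun k => U k, fun _ => rfl, fun i j hij => h.strictMono (by simpa using hij),
    fun i j => ?_⟩
  rw [← h.add_period]
  exact h.strictMono (by omega)

end IsPeriodicLift

theorem CyclicallyOrdered.exists_isPeriodicLift {n : ℕ} [NeZero n] {x : Fin n → Circle'}
    (hx : CyclicallyOrdered x) :
    ∃ X, IsPeriodicLift n X ∧ ∀ i : ℤ, (X i : Circle') = zmodIndex x (i : ZMod n) := by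
  obtain ⟨t, ht, hmono, hlt⟩ := hx
  have hn : (0 : ℤ) < n := by exact_mod_cast Nat.pos_of_neZero n
  refine ⟨fun i => t ⟨(i : ZMod n).val, ZMod.val_lt _⟩ + ((i / n : ℤ) : ℝ), ⟨fun i j hij => ?_,
    fun i => ?_⟩, fun i => ?_⟩
  · have hle : i / n ≤ j / n := Int.ediv_le_ediv hn hij.le
    rcases hle.eq_or_lt with heq | hlt'
    · rw [heq]
      refine add_lt_add_left (hmono ?_) _
      rw [Fin.mk_lt_mk]
      zify
      rw [ZMod.val_intCast, ZMod.val_intCast]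
      have h1 := Int.emod_add_mul_ediv i n
      have h2 := Int.emod_add_mul_ediv j n
      rw [heq] at h1
      linarith
    · have h1 : ((i / n : ℤ) : ℝ) + 1 ≤ ((j / n : ℤ) : ℝ) := by exact_mod_cast hlt'
      have h2 := hlt ⟨(i : ZMod n).val, ZMod.val_lt _⟩ ⟨(j : ZMod n).val, ZMod.val_lt _⟩
      linarith
  · have h1 : (i + n) / (n : ℤ) = i / n + 1 := by
      rw [Int.add_ediv_of_dvd_right (dvd_refl _), Int.ediv_self hn.ne']
    simp only [h1, Int.cast_add, Int.cast_natCast, CharP.cast_eq_zero, add_zero, Int.cast_one]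
    ring
  · rw [coe_add_intCast, ht]
    rfl

theorem sbtw'_coe_iff {t a b c : ℝ} (ha : a ∈ Set.Ico t (t + 1)) (hb : b ∈ Set.Ico t (t + 1))
    (hc : c ∈ Set.Ico t (t + 1)) :
    Sbtw' a b c ↔ a < b ∧ b < c ∨ b < c ∧ c < a ∨ c < a ∧ a < b := by
  obtain ⟨ha0, ha1⟩ := ha
  obtain ⟨hb0, hb1⟩ := hb
  obtain ⟨hc0, hc1⟩ := hc
  constructor
  · rintro ⟨a', b', c', ha', hb', hc', hab, hbc, hca⟩
    obtain ⟨i, rfl⟩ := coe_eq_coe_iff.1 ha'.symm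
    obtain ⟨j, rfl⟩ := coe_eq_coe_iff.1 hb'.symm
    obtain ⟨k, rfl⟩ := coe_eq_coe_iff.1 hc'.symm
    have hj : j = i ∨ j = i + 1 := by
      have h1 : i < j + 1 := by
        have : (i : ℝ) < j + 1 := by linarith
        exact_mod_cast this
      have h2 : j < i + 2 := by
        have : (j : ℝ) < i + 2 := by linarith
        exact_mod_cast this
      omega
    have hk : k = i ∨ k = i + 1 := by
      have h1 : i < k + 1 := by
        have : (i : ℝ) < k + 1 := by linarith
        exact_mod_cast this
      have h2 : k < i + 2 := by
        have : (k : ℝ) < i + 2 := by linarith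
        exact_mod_cast this
      omega
    rcases hj with rfl | rfl <;> rcases hk with rfl | rfl <;> push_cast at *
    · left; constructor <;> linarith
    · right; right; constructor <;> linarith
    · linarith
    · right; left; constructor <;> linarith
  · have h1 : ∀ r : ℝ, ((r + 1 : ℝ) : Circle') = (r : Circle') := AddCircle.coe_add_period 1
    rintro (⟨h, h'⟩ | ⟨h, h'⟩ | ⟨h, h'⟩)
    · exact ⟨a, b, c, rfl, rfl, rfl, h, h', by linarith⟩
    · exact ⟨a, b + 1, c + 1, rfl, h1 b, h1 c, by linarith, by linarith, by linarith⟩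
    · exact ⟨a, b, c + 1, rfl, rfl, h1 c, h', by linarith, by linarith⟩

/-- Cyclic orderedness of a tuple only depends on the ternary relation `Sbtw'`. -/
theorem cyclicallyOrdered_iff {n : ℕ} {x : Fin n → Circle'} :
    CyclicallyOrdered x ↔
      Function.Injective x ∧ ∀ i j k, i < j → j < k → Sbtw' (x i) (x j) (x k) := by
  constructor
  · rintro ⟨t, ht, hmono, hlt⟩
    refine ⟨fun i j hij => ?_, fun i j k hij hjk =>
      ⟨t i, t j, t k, ht i, ht j, ht k, hmono hij, hmono hjk, hlt k i⟩⟩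
    wlog hle : i ≤ j generalizing i j
    · exact (this j i hij.symm (le_of_not_ge hle)).symm
    rw [← ht, ← ht] at hij
    have h := coe_injOn_Ico (t i) ⟨le_rfl, by linarith⟩ ⟨hmono.monotone hle, hlt j i⟩ hij
    exact hmono.injective h
  · rintro ⟨hinj, hs⟩
    obtain _ | n := n
    · exact ⟨fun _ => 0, fun i => i.elim0, fun i => i.elim0, fun i => i.elim0⟩
    obtain ⟨t0, -, ht0⟩ := exists_mem_Ico_coe_eq 0 (x 0)
    choose t ht htx using fun i => exists_mem_Ico_coe_eq t0 (x i)
    have h0 : t 0 = t0 :=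
      coe_injOn_Ico t0 (ht 0) ⟨le_rfl, by linarith⟩ ((htx 0).trans ht0.symm)
    refine ⟨t, htx, fun i j hij => ?_, fun i j => by linarith [(ht i).2, (ht j).1]⟩
    rcases eq_or_ne i 0 with rfl | hi
    · rw [h0]
      refine lt_of_le_of_ne (ht j).1 fun h => hij.ne (hinj ?_)
      rw [← htx j, ← h, ht0]
    · have h := hs 0 i j (Fin.pos_of_ne_zero hi) hij
      rw [← htx 0, ← htx i, ← htx j, sbtw'_coe_iff (ht 0) (ht i) (ht j), h0] at h
      rcases h with h | h | h
      · exact h.2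
      · linarith [(ht j).1]
      · linarith [(ht j).1]

theorem CyclicallyOrdered.map {n : ℕ} {x : Fin n → Circle'} (hx : CyclicallyOrdered x)
    {g : Equiv.Perm Circle'} (hg : PreservesCyclicOrder g) : CyclicallyOrdered fun k => g (x k) := by
  rw [cyclicallyOrdered_iff] at hx ⊢
  exact ⟨g.injective.comp hx.1, fun i j k hij hjk => (hg _ _ _).1 (hx.2 i j k hij hjk)⟩

theorem PreservesCyclicOrder.symm {g : Equiv.Perm Circle'} (hg : PreservesCyclicOrder g) :
    PreservesCyclicOrder g.symm := fun x y z => by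
  simpa using (hg (g.symm x) (g.symm y) (g.symm z)).symm

/-- The order automorphism of `ℝ` fixing `(-∞, c]` and scaling `[c, ∞)` by `r` about `c`. -/
noncomputable def stretchAfter (c r : ℝ) (hr : 0 < r) : ℝ ≃o ℝ :=
  StrictMono.orderIsoOfRightInverse (fun t => if t ≤ c then t else c + r * (t - c))
    (by
      intro a b hab
      dsimp only
      split_ifs with h1 h2 h2
      · exact hab
      · nlinarith
      · linarith
      · nlinarith)
    (fun t => if t ≤ c then t else c + r⁻¹ * (t - c))
    (by
      intro t
      dsimp only
      split_ifs with h1 h2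
      · rfl
      · have : 0 < r⁻¹ * (t - c) := mul_pos (inv_pos.2 hr) (by linarith)
        linarith
      · field_simp
        ring)

theorem stretchAfter_of_le {c r t : ℝ} (hr : 0 < r) (h : t ≤ c) : stretchAfter c r hr t = t :=
  if_pos h

theorem stretchAfter_of_lt {c r t : ℝ} (hr : 0 < r) (h : c < t) :
    stretchAfter c r hr t = c + r * (t - c) :=
  if_neg h.not_ge

theorem exists_orderIso_apply_eq {a b : ℕ → ℝ} (ha : StrictMono a) (hb : StrictMono b) (N : ℕ) :
    ∃ f : ℝ ≃o ℝ, ∀ k ≤ N, f (a k) = b k := by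
  induction N with
  | zero => exact ⟨OrderIso.addRight (b 0 - a 0), by simp⟩
  | succ N ih =>
    obtain ⟨f, hf⟩ := ih
    have h1 : 0 < b (N + 1) - b N := sub_pos.2 (hb N.lt_succ_self)
    have h2 : b N < f (a (N + 1)) := by
      rw [← hf N le_rfl]
      exact f.strictMono (ha N.lt_succ_self)
    have h3 : 0 < f (a (N + 1)) - b N := sub_pos.2 h2
    refine ⟨f.trans (stretchAfter (b N) _ (div_pos h1 h3)), fun k hk => ?_⟩
    rw [OrderIso.trans_apply]
    rcases Nat.le_succ_iff.1 hk with hk | rfl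
    · rw [hf k hk, stretchAfter_of_le _ (hb.monotone hk)]
    · rw [stretchAfter_of_lt _ h2]
      field_simp
      ring

/-- Order automorphisms of `ℝ` carrying one fundamental interval to another induce
cyclic-order-preserving bijections of the circle. -/
theorem exists_preservesCyclicOrder_of_orderIso (f : ℝ ≃o ℝ) {s t : ℝ} (hs : f s = t)
    (hs' : f (s + 1) = t + 1) :
    ∃ g : Equiv.Perm Circle', PreservesCyclicOrder g ∧
      ∀ a ∈ Set.Ico s (s + 1), g a = (f a : ℝ) := by
  have hmem : ∀ a, a ∈ Set.Ico s (s + 1) ↔ f a ∈ Set.Ico t (t + 1) := fun a => by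
    rw [Set.mem_Ico, Set.mem_Ico, ← hs', ← hs, f.le_iff_le, f.lt_iff_lt]
  choose r hr hrx using exists_mem_Ico_coe_eq s
  have hbij : Function.Bijective fun x => ((f (r x) : ℝ) : Circle') := by
    constructor
    · intro x y hxy
      rw [← hrx x, ← hrx y,
        f.injective (coe_injOn_Ico t ((hmem _).1 (hr x)) ((hmem _).1 (hr y)) hxy)]
    · intro y
      obtain ⟨b, hb, rfl⟩ := exists_mem_Ico_coe_eq t y
      have hb' : f.symm b ∈ Set.Ico s (s + 1) := by rwa [hmem, f.apply_symm_apply]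
      refine ⟨(f.symm b : ℝ), ?_⟩
      simp only [coe_injOn_Ico s (hr _) hb' (hrx _), f.apply_symm_apply]
  refine ⟨Equiv.ofBijective _ hbij, fun x y z => ?_, fun a ha => ?_⟩
  · simp only [Equiv.ofBijective_apply]
    rw [sbtw'_coe_iff ((hmem _).1 (hr x)) ((hmem _).1 (hr y)) ((hmem _).1 (hr z))]
    conv_lhs => rw [← hrx x, ← hrx y, ← hrx z, sbtw'_coe_iff (hr x) (hr y) (hr z)]
    simp only [f.lt_iff_lt]
  · simp only [Equiv.ofBijective_apply, coe_injOn_Ico s (hr _) ha (hrx _)]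

theorem IsPeriodicLift.exists_preservesCyclicOrder {N : ℕ} {U V : ℤ → ℝ}
    (hU : IsPeriodicLift N U) (hV : IsPeriodicLift N V) :
    ∃ g : Equiv.Perm Circle', PreservesCyclicOrder g ∧ ∀ k : ℕ, k < N → g (U k) = V k := by
  obtain ⟨f, hf⟩ := exists_orderIso_apply_eq (a := fun k => U k) (b := fun k => V k)
    (hU.strictMono.comp Nat.strictMono_cast) (hV.strictMono.comp Nat.strictMono_cast) N
  have hU0 := hU.add_period 0
  have hV0 := hV.add_period 0
  rw [zero_add] at hU0 hV0
  obtain ⟨g, hg, hgf⟩ := exists_preservesCyclicOrder_of_orderIso f (s := U 0) (t := V 0)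
    (hf 0 N.zero_le) (by rw [← hU0, ← hV0]; exact hf N le_rfl)
  refine ⟨g, hg, fun k hk => ?_⟩
  rw [hgf, hf k hk.le]
  rw [← hU0]
  exact ⟨hU.strictMono.monotone (by omega), hU.strictMono (by omega)⟩

theorem List.exists_sum_take_eq {l : List ℕ} (hl : ∀ e ∈ l, e ≤ 1) {i : ℕ} (hi : i < l.sum) :
    ∃ k, ∃ hk : k < l.length, l[k] = 1 ∧ (l.take k).sum = i := by
  induction l generalizing i with
  | nil => simp at hi
  | cons a l ih =>
    have hl' : ∀ e ∈ l, e ≤ 1 := fun e he => hl e (List.mem_cons_of_mem _ he)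
    have ha := hl a List.mem_cons_self
    rw [List.sum_cons] at hi
    by_cases h0 : a = 1 ∧ i = 0
    · exact ⟨0, by simp, h0.1, by simp [h0.2]⟩
    · obtain ⟨k, hk, h1, h2⟩ := ih hl' (i := i - a) (by omega)
      exact ⟨k + 1, by simpa using hk, by simpa using h1, by
        rw [List.take_succ_cons, List.sum_cons]; omega⟩

theorem List.sum_take_lt_sum_take {l : List ℕ} {j k : ℕ} (hj : j < l.length) (h : l[j] = 1)
    (hjk : j < k) : (l.take j).sum < (l.take k).sum := by
  have h1 : (l.take (j + 1)).sum = (l.take j).sum + 1 := by rw [List.sum_take_succ _ _ hj, h]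
  have h2 : (l.take (j + 1)).sum ≤ (l.take k).sum := List.monotone_sum_take l hjk
  omega

theorem List.sum_take_lt_sum {l : List ℕ} {j : ℕ} (hj : j < l.length) (h : l[j] = 1) :
    (l.take j).sum < l.sum := by
  simpa using List.sum_take_lt_sum_take hj h hj

theorem List.sum_take_inj {l : List ℕ} {j k : ℕ} (hj : j < l.length) (h : l[j] = 1)
    (hk : k < l.length) (h' : l[k] = 1) (heq : (l.take j).sum = (l.take k).sum) : j = k := by
  rcases lt_trichotomy j k with hlt | rfl | hlt
  · exact absurd heq (List.sum_take_lt_sum_take hj h hlt).ne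
  · rfl
  · exact absurd heq (List.sum_take_lt_sum_take hk h' hlt).ne'

theorem List.exists_add_sum_take_eq {n : ℕ} [NeZero n] {l : List ℕ} (hl : ∀ e ∈ l, e ≤ 1)
    (hsum : l.sum = n) (v z : ZMod n) :
    ∃ k, ∃ hk : k < l.length, l[k] = 1 ∧ v + ((l.take k).sum : ℕ) = z := by
  obtain ⟨k, hk, h1, h2⟩ := List.exists_sum_take_eq hl ((ZMod.val_lt (z - v)).trans_eq hsum.symm)
  exact ⟨k, hk, h1, by rw [h2, ZMod.natCast_zmod_val, add_sub_cancel]⟩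

/-- Walking along the points `U 0, U 1, …`, the list `l` has a `1` exactly where a point of
the tuple `x` is met, the first such point having index `v`. -/
def Marks {n : ℕ} [NeZero n] (x : Fin n → Circle') (v : ZMod n) (l : List ℕ) (U : ℤ → ℝ) : Prop :=
  ∀ (k : ℕ) (hk : k < l.length), l[k] = 1 →
    zmodIndex x (v + ((l.take k).sum : ℕ)) = (U k : Circle')

namespace Marks

variable {n N : ℕ} [NeZero n] {x : Fin n → Circle'} {v : ZMod n} {l : List ℕ} {U : ℤ → ℝ}

theorem exists_eq (h : Marks x v l U) (hl : ∀ e ∈ l, e ≤ 1) (hsum : l.sum = n) (i : Fin n) :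
    ∃ k, ∃ hk : k < l.length, l[k] = 1 ∧ x i = (U k : Circle') := by
  obtain ⟨k, hk, h1, h2⟩ := List.exists_add_sum_take_eq hl hsum v ((i : ℕ) : ZMod n)
  exact ⟨k, hk, h1, by rw [← h k hk h1, h2, zmodIndex_fin]⟩

theorem map (h : Marks x v l U) {g : Circle' → Circle'} {V : ℤ → ℝ}
    (hg : ∀ k : ℕ, k < l.length → g (U k) = V k) : Marks (fun i => g (x i)) v l V :=
  fun k hk h1 => (congrArg g (h k hk h1)).trans (hg k hk)

theorem apply_eq (h : Marks x v l U) (hl : ∀ e ∈ l, e ≤ 1) (hsum : l.sum = n)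
    {x' : Fin n → Circle'} {V : ℤ → ℝ} (h' : Marks x' v l V) {g : Circle' → Circle'}
    (hg : ∀ k : ℕ, k < l.length → g (U k) = V k) (i : Fin n) : g (x i) = x' i := by
  obtain ⟨k, hk, h1, h2⟩ := List.exists_add_sum_take_eq hl hsum v ((i : ℕ) : ZMod n)
  have hx := h k hk h1
  have hx' := h' k hk h1
  rw [h2, zmodIndex_fin] at hx hx'
  rw [hx, hx', hg k hk]

theorem rotate {a : ℕ} (h : Marks x v (a :: l) U) (hU : IsPeriodicLift (l.length + 1) U)
    (hsum : (a :: l).sum = n) : Marks x (v + a) (l ++ [a]) fun i => U (i + 1) := by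
  intro k hk h1
  rcases (Nat.lt_succ_iff.1 (by simpa using hk) : k ≤ l.length).lt_or_eq with hlt | rfl
  · have := h (k + 1) (by simpa using hlt) (by simpa [List.getElem_append_left hlt] using h1)
    rw [List.take_succ_cons, List.sum_cons] at this
    rw [List.take_append_of_le_length hlt.le]
    push_cast at this ⊢
    rwa [add_assoc]
  · have hx := h 0 (by simp) (by simpa using h1)
    have hn : (a : ZMod n) + (l.sum : ℕ) = 0 := by
      rw [← Nat.cast_add, ← List.sum_cons, hsum, ZMod.natCast_self]
    have hp := hU.add_period 0
    push_cast at hp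
    rw [zero_add] at hp
    rw [List.take_zero, List.sum_nil, Nat.cast_zero, add_zero, Nat.cast_zero] at hx
    rw [List.take_left, add_assoc, hn, add_zero, hx]
    exact ((congrArg _ hp).trans (AddCircle.coe_add_period 1 _)).symm

theorem getElem_eq_one_iff (h : Marks x v l U) (hU : IsPeriodicLift l.length U)
    (hl : ∀ e ∈ l, e ≤ 1) (hsum : l.sum = n) {k : ℕ} (hk : k < l.length) :
    l[k] = 1 ↔ (U k : Circle') ∈ Set.range x := by
  refine ⟨fun h1 => ⟨_, h k hk h1⟩, ?_⟩
  rintro ⟨i, hi⟩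
  obtain ⟨j, hj, h1, h2⟩ := h.exists_eq hl hsum i
  have := (cyclicallyOrdered_iff.1 hU.cyclicallyOrdered).1
    (a₁ := ⟨j, hj⟩) (a₂ := ⟨k, hk⟩) (h2.symm.trans hi)
  obtain rfl : j = k := by simpa using this
  exact h1

theorem unique (hx : Function.Injective x) (h : Marks x v l U) (hU : IsPeriodicLift l.length U)
    (hl : ∀ e ∈ l, e ≤ 1) (hsum : l.sum = n) {v' : ZMod n} {l' : List ℕ} {V : ℤ → ℝ}
    (h' : Marks x v' l' V) (hV : IsPeriodicLift l'.length V) (hl' : ∀ e ∈ l', e ≤ 1)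
    (hsum' : l'.sum = n) (hlen : l.length = l'.length)
    (hUV : ∀ k : ℕ, k < l.length → (U k : Circle') = V k) : v = v' ∧ l = l' := by
  have hll : l = l' := by
    refine List.ext_getElem hlen fun k hk hk' => ?_
    have h1 := h.getElem_eq_one_iff hU hl hsum hk
    rw [hUV k hk, ← h'.getElem_eq_one_iff hV hl' hsum' hk'] at h1
    have h2 := hl _ (List.getElem_mem hk)
    have h3 := hl' _ (List.getElem_mem hk')
    omega
  subst hll
  obtain ⟨k, hk, h1, -⟩ := List.exists_add_sum_take_eq hl hsum v v
  have h2 := hx (((h k hk h1).trans (hUV k hk)).trans (h' k hk h1).symm)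
  exact ⟨add_right_cancel (ZMod.val_injective n (Fin.mk.inj h2)), rfl⟩

end Marks

theorem IsPeriodicLift.exists_marks {n : ℕ} [NeZero n] {U : ℤ → ℝ} {l : List ℕ}
    (hU : IsPeriodicLift l.length U) (hl : ∀ e ∈ l, e ≤ 1) (hsum : l.sum = n) (v : ZMod n) :
    ∃ x : Fin n → Circle', CyclicallyOrdered x ∧ Marks x v l U := by
  choose κ hκ h1 h2 using fun i : Fin n =>
    List.exists_sum_take_eq hl (i := i) (hsum.symm ▸ i.2)
  have hmono : StrictMono κ := fun i j hij => by
    by_contra! hle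
    have := List.monotone_sum_take l hle
    simp only [h2] at this
    omega
  have hx₀ : CyclicallyOrdered fun i => (U (κ i) : Circle') :=
    ⟨fun i => U (κ i), fun _ => rfl,
      fun i j hij => hU.strictMono (by exact_mod_cast hmono hij), fun i j => by
        rw [← hU.add_period]
        exact hU.strictMono (by have := hκ i; omega)⟩
  obtain ⟨X, hX, hXx⟩ := hx₀.exists_isPeriodicLift
  refine ⟨_, (hX.comp_add (-v.val)).cyclicallyOrdered, fun k hk hk1 => ?_⟩
  have hlt : (l.take k).sum < n := hsum ▸ List.sum_take_lt_sum hk hk1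
  rw [zmodIndex, hXx]
  rw [Int.cast_add, Int.cast_neg, Int.cast_natCast, Int.cast_natCast, ZMod.natCast_zmod_val,
    ZMod.natCast_zmod_val, add_neg_cancel_comm, zmodIndex_natCast _ hlt,
    List.sum_take_inj (hκ _) (h1 _) hk hk1 (h2 _)]

theorem CyclicallyOrdered.exists_strictMono_mem_Ico {n : ℕ} [NeZero n] {x : Fin n → Circle'}
    (hx : CyclicallyOrdered x) :
    ∃ (a : Fin n → ℝ) (v : ZMod n), StrictMono a ∧ (∀ i, a i ∈ Set.Ico (0 : ℝ) 1) ∧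
      ∀ i : Fin n, zmodIndex x (v + (i : ℕ)) = ((a i : ℝ) : Circle') := by
  obtain ⟨X, hX, hXx⟩ := hx.exists_isPeriodicLift
  have hmul : ∀ k : ℕ, X (n * k) = X 0 + k := fun k => by
    induction k with
    | zero => simp
    | succ k ih =>
      push_cast
      rw [mul_add, mul_one, hX.add_period, ih, add_assoc]
  have hneg : ∀ k : ℕ, X (-(n * k)) = X 0 - k := fun k => by
    induction k with
    | zero => simp
    | succ k ih =>
      have := hX.add_period (-(n * (k + 1)))
      rw [show (-(n * (k + 1)) + n : ℤ) = -(n * k) by ring, ih] at this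
      push_cast
      linarith
  obtain ⟨r, hr, hmin⟩ := Int.exists_least_of_bdd (P := fun i => 0 ≤ X i)
    (by
      obtain ⟨k, hk⟩ := exists_nat_gt (X 0)
      refine ⟨-(n * k), fun z hz => ?_⟩
      by_contra! hlt
      have := hX.strictMono hlt
      rw [hneg] at this
      linarith)
    (by
      obtain ⟨k, hk⟩ := exists_nat_gt (-X 0)
      exact ⟨n * k, by rw [hmul]; linarith⟩)
  refine ⟨fun i => X (i + r), r, fun i j hij => hX.strictMono (by simpa using hij),
    fun i => ⟨hr.trans (hX.strictMono.monotone (by omega)), ?_⟩, fun i => ?_⟩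
  · have h1 : X (r - 1) < 0 := by
      by_contra! h
      have := hmin _ h
      omega
    have h2 : X (i + r) ≤ X (r - 1 + n) := hX.strictMono.monotone (by omega)
    rw [hX.add_period] at h2
    linarith
  · rw [hXx]
    push_cast
    rw [add_comm]

/-- The `0`-`1` list of length `N` with ones at the positions in the range of `κ`. -/
noncomputable def rangeIndicator {n N : ℕ} (κ : Fin n → Fin N) : List ℕ :=
  open Classical in List.ofFn fun k => if k ∈ Set.range κ then 1 else 0

theorem length_rangeIndicator {n N : ℕ} (κ : Fin n → Fin N) : (rangeIndicator κ).length = N :=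
  List.length_ofFn

theorem sum_take_rangeIndicator {n N : ℕ} {κ : Fin n → Fin N} (hκ : Function.Injective κ) (k : ℕ) :
    ((rangeIndicator κ).take k).sum = Finset.card {i : Fin n | (κ i : ℕ) < k} := by
  classical
  rw [rangeIndicator, List.sum_take_ofFn, Finset.sum_boole, Finset.filter_filter, Nat.cast_id,
    ← Finset.card_image_of_injective _ hκ]
  congr 1
  ext j
  simp only [Finset.mem_filter, Finset.mem_univ, true_and, Finset.mem_image, Set.mem_range]
  constructor
  · rintro ⟨hj, i, rfl⟩
    exact ⟨i, hj, rfl⟩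
  · rintro ⟨i, hi, rfl⟩
    exact ⟨hi, i, rfl⟩

theorem sum_rangeIndicator {n N : ℕ} {κ : Fin n → Fin N} (hκ : Function.Injective κ) :
    (rangeIndicator κ).sum = n := by
  have := sum_take_rangeIndicator hκ N
  rwa [List.take_of_length_le (length_rangeIndicator κ).le,
    Finset.filter_true_of_mem fun i _ => (κ i).2, Finset.card_fin] at this

theorem marks_rangeIndicator {n N : ℕ} [NeZero n] {κ : Fin n → Fin N} (hκ : StrictMono κ)
    {x : Fin n → Circle'} {v : ZMod n} {U : ℤ → ℝ}
    (h : ∀ i : Fin n, zmodIndex x (v + (i : ℕ)) = (U (κ i) : Circle')) :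
    Marks x v (rangeIndicator κ) U := by
  intro k hk h1
  simp only [rangeIndicator, List.getElem_ofFn, ite_eq_left_iff, zero_ne_one, imp_false,
    not_not] at h1
  obtain ⟨i, hi⟩ := h1
  have hki : k = κ i := by rw [hi]
  rw [hki, sum_take_rangeIndicator hκ.injective, ← h]
  congr 3
  simp only [Fin.val_fin_lt, hκ.lt_iff_lt]
  rw [Finset.filter_gt_eq_Iio, Fin.card_Iio]

theorem IsPeriodicLift.coe_injective {N : ℕ} {U : ℤ → ℝ} (hU : IsPeriodicLift N U) :
    Function.Injective fun k : Fin N => (U k : Circle') :=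
  (cyclicallyOrdered_iff.1 hU.cyclicallyOrdered).1

theorem IsPeriodicLift.eq_of_range_eq {N M : ℕ} {U V : ℤ → ℝ} (hU : IsPeriodicLift N U)
    (hV : IsPeriodicLift M V) (h0 : (U 0 : Circle') = V 0)
    (hrange : (Set.range fun k : Fin N => (U k : Circle')) =
      Set.range fun k : Fin M => (V k : Circle')) :
    N = M ∧ ∀ k : ℕ, k < N → (U k : Circle') = V k := by
  have hNM : N = M := by
    have := Nat.card_range_of_injective hU.coe_injective
    rw [hrange, Nat.card_range_of_injective hV.coe_injective] at this
    simpa using this.symm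
  subst hNM
  refine ⟨rfl, fun k hk => ?_⟩
  obtain ⟨c, hc⟩ := coe_eq_coe_iff.1 h0
  have hmem {W : ℤ → ℝ} (hW : IsPeriodicLift N W) (k : Fin N) : W k ∈ Set.Ico (W 0) (W 0 + 1) := by
    rw [← hW.add_period]
    exact ⟨hW.strictMono.monotone (by omega), hW.strictMono (by omega)⟩
  have hU' := hU.add_const c
  have hcoe (k : ℤ) : ((U k + c : ℝ) : Circle') = U k := coe_add_intCast _ _
  have hsub {W W' : ℤ → ℝ} (hW : IsPeriodicLift N W) (hW' : IsPeriodicLift N W')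
      (h0 : W 0 = W' 0) (hr : (Set.range fun k : Fin N => (W k : Circle')) ⊆
        Set.range fun k : Fin N => (W' k : Circle')) :
      (Set.range fun k : Fin N => W k) ⊆ Set.range fun k : Fin N => W' k := by
    rintro _ ⟨k, rfl⟩
    obtain ⟨j, hj⟩ := hr ⟨k, rfl⟩
    exact ⟨j, coe_injOn_Ico (W 0) (h0 ▸ hmem hW' j) (hmem hW k) hj⟩
  have hmono {W : ℤ → ℝ} (hW : IsPeriodicLift N W) : StrictMono fun k : Fin N => W k :=
    fun i j hij => hW.strictMono (by simpa using hij)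
  have heq := ((hmono hU').range_inj (hmono hV)).1 <|
    (hsub hU' hV hc.symm (by simp only [hcoe]; exact hrange.le)).antisymm
      (hsub hV hU' hc (by simp only [hcoe]; exact hrange.ge))
  rw [← hcoe]
  exact congrArg _ (congrFun heq ⟨k, hk⟩)

theorem IsDelannoyStep.fst_le {p : ℕ × ℕ} (h : IsDelannoyStep p) : p.1 ≤ 1 := by
  rcases h with rfl | rfl | rfl <;> simp

theorem IsDelannoyStep.snd_le {p : ℕ × ℕ} (h : IsDelannoyStep p) : p.2 ≤ 1 := by
  rcases h with rfl | rfl | rfl <;> simp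

theorem IsDelannoyStep.fst_eq_or_snd_eq {p : ℕ × ℕ} (h : IsDelannoyStep p) : p.1 = 1 ∨ p.2 = 1 := by
  rcases h with rfl | rfl | rfl <;> simp

namespace BasedLoop

variable {n m : ℕ} (b : BasedLoop n m)

theorem fst_le : ∀ e ∈ b.1.2.map Prod.fst, e ≤ 1 := by
  simpa only [List.forall_mem_map] using fun p hp => (b.2.1 p hp).fst_le

theorem snd_le : ∀ e ∈ b.1.2.map Prod.snd, e ≤ 1 := by
  simpa only [List.forall_mem_map] using fun p hp => (b.2.1 p hp).snd_le

theorem sum_fst : (b.1.2.map Prod.fst).sum = n := by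
  have := map_list_sum (AddMonoidHom.fst ℕ ℕ) b.1.2
  rw [b.2.2] at this
  exact this.symm

theorem sum_snd : (b.1.2.map Prod.snd).sum = m := by
  have := map_list_sum (AddMonoidHom.snd ℕ ℕ) b.1.2
  rw [b.2.2] at this
  exact this.symm

theorem exists_loopRot {v : ZMod n × ZMod m} {s : ℕ × ℕ} {L : List (ℕ × ℕ)}
    (h : b.1 = (v, s :: L)) :
    ∃ b' : BasedLoop n m, LoopRot n m b b' := by
  obtain ⟨b, hb, hsum⟩ := b
  subst h
  exact ⟨⟨(v + ((s.1 : ZMod n), (s.2 : ZMod m)), L ++ [s]),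
    fun p hp => hb p (by simpa [or_comm] using hp), by simpa [add_comm] using hsum⟩,
    v, s, L, rfl, rfl⟩

end BasedLoop

theorem GRel.symm {n m : ℕ} {p q : CyclicPair n m} (h : GRel n m p q) : GRel n m q p := by
  obtain ⟨g, hg, hx, hy⟩ := h
  exact ⟨g.symm, hg.symm, fun k => by rw [← hx, g.symm_apply_apply],
    fun k => by rw [← hy, g.symm_apply_apply]⟩

section Realizes

variable {n m : ℕ} [NeZero n] [NeZero m] {p q : CyclicPair n m} {b b' : BasedLoop n m}
  {U V : ℤ → ℝ}

/-- The loop `b` records the order in which the points of the two tuples of `p` are met along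
the sequence of points `U 0, U 1, …` going once around the circle. -/
structure RealizesAlong (p : CyclicPair n m) (b : BasedLoop n m) (U : ℤ → ℝ) : Prop where
  isPeriodicLift : IsPeriodicLift b.1.2.length U
  fst : Marks p.1.1 b.1.1.1 (b.1.2.map Prod.fst) U
  snd : Marks p.2.1 b.1.1.2 (b.1.2.map Prod.snd) U

/-- The loop `b` records the cyclic order of the points of the two tuples of `p`. -/
def Realizes (p : CyclicPair n m) (b : BasedLoop n m) : Prop :=
  ∃ U, RealizesAlong p b U

theorem RealizesAlong.loopRot (h : RealizesAlong p b U) (hb : LoopRot n m b b') :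
    RealizesAlong p b' fun i => U (i + 1) := by
  obtain ⟨v, s, L, h1, h2⟩ := hb
  obtain ⟨hU, hx, hy⟩ := h
  have hs1 := b.sum_fst
  have hs2 := b.sum_snd
  rw [h1] at hU hx hy hs1 hs2
  rw [List.length_cons] at hU
  rw [List.map_cons] at hx hy hs1 hs2
  constructor
  · rw [h2, List.length_append, List.length_singleton]
    exact hU.comp_add 1
  · rw [h2, List.map_append]
    exact hx.rotate (by rwa [List.length_map]) hs1
  · rw [h2, List.map_append]
    exact hy.rotate (by rwa [List.length_map]) hs2

theorem RealizesAlong.exists_rotate (h : RealizesAlong p b U) (k : ℕ) :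
    ∃ b', Quot.mk (LoopRot n m) b = Quot.mk _ b' ∧ RealizesAlong p b' fun i => U (i + k) := by
  induction k with
  | zero => exact ⟨b, rfl, by simpa using h⟩
  | succ k ih =>
    obtain ⟨b₁, hb₁, h₁⟩ := ih
    obtain ⟨s, L, hsL⟩ := List.exists_cons_of_length_pos h₁.isPeriodicLift.pos
    obtain ⟨b₂, hrot⟩ := b₁.exists_loopRot (v := b₁.1.1) (Prod.ext rfl hsL)
    refine ⟨b₂, hb₁.trans (Quot.sound hrot), ?_⟩
    convert h₁.loopRot hrot using 3
    push_cast
    ring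

theorem RealizesAlong.range_eq (h : RealizesAlong p b U) :
    (Set.range fun k : Fin b.1.2.length => (U k : Circle')) =
      Set.range p.1.1 ∪ Set.range p.2.1 := by
  apply Set.Subset.antisymm
  · rintro _ ⟨k, rfl⟩
    rcases (b.2.1 _ (List.getElem_mem k.2)).fst_eq_or_snd_eq with h1 | h1
    · exact Or.inl ⟨_, h.fst k (by simp) (by simpa using h1)⟩
    · exact Or.inr ⟨_, h.snd k (by simp) (by simpa using h1)⟩
  · rintro _ (⟨i, rfl⟩ | ⟨i, rfl⟩)
    · obtain ⟨k, hk, -, h2⟩ := h.fst.exists_eq b.fst_le b.sum_fst i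
      exact ⟨⟨k, by simpa using hk⟩, h2.symm⟩
    · obtain ⟨k, hk, -, h2⟩ := h.snd.exists_eq b.snd_le b.sum_snd i
      exact ⟨⟨k, by simpa using hk⟩, h2.symm⟩

theorem RealizesAlong.unique (h : RealizesAlong p b U) (h' : RealizesAlong p b' V)
    (h0 : (U 0 : Circle') = V 0) : b = b' := by
  obtain ⟨hlen, hUV⟩ := h.isPeriodicLift.eq_of_range_eq h'.isPeriodicLift h0
    (h.range_eq.trans h'.range_eq.symm)
  obtain ⟨hv1, hs1⟩ := h.fst.unique (cyclicallyOrdered_iff.1 p.1.2).1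
    (by simpa using h.isPeriodicLift) b.fst_le b.sum_fst h'.fst
    (by simpa using h'.isPeriodicLift) b'.fst_le b'.sum_fst (by simpa using hlen)
    (by simpa using hUV)
  obtain ⟨hv2, hs2⟩ := h.snd.unique (cyclicallyOrdered_iff.1 p.2.2).1
    (by simpa using h.isPeriodicLift) b.snd_le b.sum_snd h'.snd
    (by simpa using h'.isPeriodicLift) b'.snd_le b'.sum_snd (by simpa using hlen)
    (by simpa using hUV)
  refine Subtype.ext (Prod.ext (Prod.ext hv1 hv2) ?_)
  rw [← List.zip_unzip b.1.2, ← List.zip_unzip b'.1.2, List.unzip_eq_map, List.unzip_eq_map, hs1,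
    hs2]

theorem Realizes.mk_eq_mk (h : Realizes p b) (h' : Realizes p b') :
    Quot.mk (LoopRot n m) b = Quot.mk (LoopRot n m) b' := by
  obtain ⟨U, h⟩ := h
  obtain ⟨V, h'⟩ := h'
  obtain ⟨k, hk⟩ : ((V (0 : ℕ) : ℝ) : Circle') ∈
      Set.range fun k : Fin b.1.2.length => (U k : Circle') := by
    rw [h.range_eq, ← h'.range_eq]
    exact ⟨⟨0, h'.isPeriodicLift.pos⟩, rfl⟩
  obtain ⟨b₁, hb₁, h₁⟩ := h.exists_rotate k
  rw [hb₁, h₁.unique h' (by simpa using hk)]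

theorem Realizes.gRel (hp : Realizes p b) (hq : Realizes q b) : GRel n m p q := by
  obtain ⟨U, hp⟩ := hp
  obtain ⟨V, hq⟩ := hq
  obtain ⟨g, hg, hgU⟩ := hp.isPeriodicLift.exists_preservesCyclicOrder hq.isPeriodicLift
  exact ⟨g, hg, hp.fst.apply_eq b.fst_le b.sum_fst hq.fst (by simpa using hgU),
    hp.snd.apply_eq b.snd_le b.sum_snd hq.snd (by simpa using hgU)⟩

theorem Realizes.of_gRel (hp : Realizes p b) (h : GRel n m p q) : Realizes q b := by
  obtain ⟨U, hp⟩ := hp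
  obtain ⟨g, hg, hx, hy⟩ := h
  have : NeZero b.1.2.length := ⟨hp.isPeriodicLift.pos.ne'⟩
  obtain ⟨V, hV, hVU⟩ := (hp.isPeriodicLift.cyclicallyOrdered.map hg).exists_isPeriodicLift
  have hgU (k : ℕ) (hk : k < b.1.2.length) : g (U k) = V k := by
    rw [hVU, Int.cast_natCast, zmodIndex_natCast _ hk]
  refine ⟨V, hV, ?_, ?_⟩
  · rw [← funext hx]
    exact hp.fst.map (by simpa using hgU)
  · rw [← funext hy]
    exact hp.snd.map (by simpa using hgU)

theorem realizes_congr (h : Quot.mk (GRel n m) p = Quot.mk (GRel n m) q) :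
    Realizes p b ↔ Realizes q b := by
  have h' := Quot.eqvGen_exact h
  clear h
  induction h' with
  | rel p q h => exact ⟨fun hp => hp.of_gRel h, fun hq => hq.of_gRel h.symm⟩
  | refl p => exact Iff.rfl
  | symm p q _ ih => exact ih.symm
  | trans p q r _ _ ih ih' => exact ih.trans ih'

theorem exists_realizes_of_loop (b : BasedLoop n m) : ∃ p, Realizes p b := by
  have hlen : 0 < b.1.2.length := by
    refine List.length_pos_iff.2 fun h => NeZero.ne n ?_
    simpa [h] using b.sum_fst.symm
  have hU : IsPeriodicLift b.1.2.length fun i => (i : ℝ) / b.1.2.length := by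
    have : (0 : ℝ) < b.1.2.length := by exact_mod_cast hlen
    refine ⟨fun i j hij => ?_, fun i => ?_⟩
    · exact div_lt_div_of_pos_right (by exact_mod_cast hij) this
    · push_cast
      field_simp
  obtain ⟨x, hx, hxU⟩ := IsPeriodicLift.exists_marks (l := b.1.2.map Prod.fst) (by simpa using hU)
    b.fst_le b.sum_fst b.1.1.1
  obtain ⟨y, hy, hyU⟩ := IsPeriodicLift.exists_marks (l := b.1.2.map Prod.snd) (by simpa using hU)
    b.snd_le b.sum_snd b.1.1.2
  exact ⟨⟨⟨x, hx⟩, ⟨y, hy⟩⟩, _, hU, hxU, hyU⟩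

theorem exists_realizes_of_pair (p : CyclicPair n m) : ∃ b, Realizes p b := by
  classical
  obtain ⟨a, v, ha, haI, hav⟩ := p.1.2.exists_strictMono_mem_Ico
  obtain ⟨c, w, hc, hcI, hcw⟩ := p.2.2.exists_strictMono_mem_Ico
  set T : Finset ℝ := Finset.univ.image a ∪ Finset.univ.image c with hT
  set e := T.orderEmbOfFin rfl with he
  have hrange : Set.range e = T := T.range_orderEmbOfFin rfl
  have hTI : ∀ t ∈ T, t ∈ Set.Ico (0 : ℝ) 1 := by
    simp only [hT, Finset.mem_union, Finset.mem_image, Finset.mem_univ, true_and]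
    rintro _ (⟨i, rfl⟩ | ⟨i, rfl⟩)
    exacts [haI i, hcI i]
  have hex (t : ℝ) (ht : t ∈ T) : ∃ k, e k = t := by
    rwa [← Finset.mem_coe, ← hrange] at ht
  choose κ hκ using fun i => hex (a i) (by simp [hT])
  choose μ hμ using fun i => hex (c i) (by simp [hT])
  have hκm : StrictMono κ := fun i j hij => by
    rw [← e.lt_iff_lt, hκ, hκ]
    exact ha hij
  have hμm : StrictMono μ := fun i j hij => by
    rw [← e.lt_iff_lt, hμ, hμ]
    exact hc hij
  have : NeZero T.card := ⟨(κ 0).pos.ne'⟩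
  have hecyc : CyclicallyOrdered fun k => (e k : Circle') :=
    ⟨e, fun _ => rfl, e.strictMono, fun i j => by
      have hi := hTI _ (T.orderEmbOfFin_mem rfl i)
      have hj := hTI _ (T.orderEmbOfFin_mem rfl j)
      linarith [hi.2, hj.1]⟩
  obtain ⟨U, hU, hUe⟩ := hecyc.exists_isPeriodicLift
  have hUk (k : Fin T.card) : (U k : Circle') = e k := by
    rw [hUe, Int.cast_natCast, zmodIndex_fin]
  have hlen : (rangeIndicator κ).length = (rangeIndicator μ).length := by
    rw [length_rangeIndicator, length_rangeIndicator]
  have hfst : ((rangeIndicator κ).zip (rangeIndicator μ)).map Prod.fst = rangeIndicator κ :=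
    List.map_fst_zip hlen.le
  have hsnd : ((rangeIndicator κ).zip (rangeIndicator μ)).map Prod.snd = rangeIndicator μ :=
    List.map_snd_zip hlen.ge
  refine ⟨⟨((v, w), (rangeIndicator κ).zip (rangeIndicator μ)), fun s hs => ?_, ?_⟩, U, ?_, ?_, ?_⟩
  · obtain ⟨k, hk, rfl⟩ := List.getElem_of_mem hs
    have hkT : k < T.card := by simpa [length_rangeIndicator] using hk
    have hk' : (∃ i, κ i = ⟨k, hkT⟩) ∨ ∃ i, μ i = ⟨k, hkT⟩ := by
      have := Finset.mem_union.1 (T.orderEmbOfFin_mem rfl ⟨k, hkT⟩)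
      rw [← he, Finset.mem_image, Finset.mem_image] at this
      refine this.imp ?_ ?_
      · rintro ⟨i, -, hi⟩
        exact ⟨i, e.injective ((hκ i).trans hi)⟩
      · rintro ⟨i, -, hi⟩
        exact ⟨i, e.injective ((hμ i).trans hi)⟩
    simp only [List.getElem_zip, rangeIndicator, List.getElem_ofFn, Set.mem_range]
    unfold IsDelannoyStep
    split_ifs <;> simp_all
  · refine Prod.ext ?_ ?_
    · refine Eq.trans ?_ ((congrArg List.sum hfst).trans (sum_rangeIndicator hκm.injective))
      exact map_list_sum (AddMonoidHom.fst ℕ ℕ) _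
    · refine Eq.trans ?_ ((congrArg List.sum hsnd).trans (sum_rangeIndicator hμm.injective))
      exact map_list_sum (AddMonoidHom.snd ℕ ℕ) _
  · simpa [length_rangeIndicator] using hU
  · exact (congrArg (Marks p.1.1 v · U) hfst).mpr <|
      marks_rangeIndicator hκm fun i => by rw [hav, hUk, hκ]
  · exact (congrArg (Marks p.2.1 w · U) hsnd).mpr <|
      marks_rangeIndicator hμm fun i => by rw [hcw, hUk, hμ]

theorem Realizes.translate_one_zero (h : Realizes p b) {p' : CyclicPair n m}
    (hx : ∀ k, p'.1.1 k = p.1.1 (k - 1)) (hy : p'.2 = p.2) : Realizes p' (b.translate 1 0) := by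
  obtain ⟨U, h⟩ := h
  refine ⟨U, h.isPeriodicLift, fun k hk h1 => ?_, ?_⟩
  · rw [← h.fst k hk h1, ← zmodIndex_add_one hx, add_right_comm]
    rfl
  · rw [hy]
    simpa [BasedLoop.translate] using h.snd

theorem Realizes.translate_zero_one (h : Realizes p b) {p' : CyclicPair n m}
    (hx : p'.1 = p.1) (hy : ∀ k, p'.2.1 k = p.2.1 (k - 1)) : Realizes p' (b.translate 0 1) := by
  obtain ⟨U, h⟩ := h
  refine ⟨U, h.isPeriodicLift, ?_, fun k hk h1 => ?_⟩
  · rw [hx]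
    simpa [BasedLoop.translate] using h.fst
  · rw [← h.snd k hk h1, ← zmodIndex_add_one hy, add_right_comm]
    rfl

end Realizes

/-- The bijection sending a configuration to the loop it realizes. -/
theorem exists_equiv_delannoyLoop (n m : ℕ) [NeZero n] [NeZero m] :
    ∃ e : Quot (GRel n m) ≃ DelannoyLoop n m,
      ∀ p b, e (Quot.mk _ p) = Quot.mk _ b ↔ Realizes p b := by
  choose f hf using exists_realizes_of_loop (n := n) (m := m)
  let F : DelannoyLoop n m → Quot (GRel n m) := Quot.lift (fun b => Quot.mk _ (f b))
    fun b b' hb => Quot.sound (Realizes.gRel ((hf b).imp' _ fun _ h => h.loopRot hb) (hf b'))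
  have hF (p b) : Quot.mk _ p = F (Quot.mk _ b) ↔ Realizes p b :=
    ⟨fun h => (realizes_congr h).2 (hf b), fun h => Quot.sound (h.gRel (hf b))⟩
  have hbij : Function.Bijective F := by
    constructor
    · rintro ⟨b⟩ ⟨b'⟩ h
      exact (hf b).mk_eq_mk ((hF _ _).1 h)
    · rintro ⟨p⟩
      obtain ⟨b, hb⟩ := exists_realizes_of_pair p
      exact ⟨Quot.mk _ b, ((hF p b).2 hb).symm⟩
  exact ⟨(Equiv.ofBijective F hbij).symm, fun p b =>
    (Equiv.symm_apply_eq _).trans (hF p b)⟩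

/-- For `n, m ≥ 1`, the `G`-orbits on `S^{{n}} × S^{{m}}` are in bijection with the
`(n,m)`-Delannoy loops (so the number of orbits is `C(n,m)`), and the bijection can
be chosen equivariantly for `ℤ/n × ℤ/m`: cyclically shifting the first tuple by one
position (`x'ₖ = x_{k−1}`) corresponds to translating the loop by `(1,0)`, and
cyclically shifting the second tuple corresponds to translating by `(0,1)`. -/
theorem orbits_equiv_delannoyLoops
    (n m : ℕ) [NeZero n] [NeZero m] :
    Nat.card (Quot (GRel n m)) = circularDelannoy n m ∧
    ∃ e : Quot (GRel n m) ≃ DelannoyLoop n m,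
      (∀ p p' : CyclicPair n m,
        (∀ k, p'.1.1 k = p.1.1 (k - 1)) → p'.2 = p.2 →
        ∀ b : BasedLoop n m,
          e (Quot.mk (GRel n m) p) = Quot.mk (LoopRot n m) b →
          e (Quot.mk (GRel n m) p') = Quot.mk (LoopRot n m) (b.translate 1 0)) ∧
      (∀ p p' : CyclicPair n m,
        p'.1 = p.1 → (∀ k, p'.2.1 k = p.2.1 (k - 1)) →
        ∀ b : BasedLoop n m,
          e (Quot.mk (GRel n m) p) = Quot.mk (LoopRot n m) b →
          e (Quot.mk (GRel n m) p') = Quot.mk (LoopRot n m) (b.translate 0 1)) := by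
  obtain ⟨e, he⟩ := exists_equiv_delannoyLoop n m
  refine ⟨Nat.card_congr e, e, fun p p' hx hy b h => ?_, fun p p' hx hy b h => ?_⟩
  · exact (he _ _).2 (((he p b).1 h).translate_one_zero hx hy)
  · exact (he _ _).2 (((he p b).1 h).translate_zero_one hx hy)
end

section
/- Let n ≥ 1 and let a ∈ S^{{n}}. Then the pointwise stabilizer G(a) = {g ∈ G | g(a_i) = a_i for all 1 ≤ i ≤ n} is isomorphic as a group to the n-fold direct product of H = (ℝ ≃o ℝ), the group of order-preserving bijections of ℝ. -/
/-- The group `G` of cyclic-order-preserving bijections of the circle, as a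
subgroup of the permutation group of the circle. -/
def CircleAutGroup : Subgroup (Equiv.Perm Circle') where
  carrier := {g | PreservesCyclicOrder g}
  one_mem' := by intro x y z; rfl
  mul_mem' := by
    intro a b ha hb x y z
    exact (hb x y z).trans (ha (b x) (b y) (b z))
  inv_mem' := by
    intro a ha x y z
    have := ha (a⁻¹ x) (a⁻¹ y) (a⁻¹ z)
    simpa using this.symm

/-- The pointwise stabilizer `G(a)` of a tuple `a` in `G`. -/
def PointwiseStab {n : ℕ} (a : Fin n → Circle') : Subgroup (Equiv.Perm Circle') where
  carrier := {g | PreservesCyclicOrder g ∧ ∀ i, g (a i) = a i}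
  one_mem' := ⟨CircleAutGroup.one_mem, fun _ => rfl⟩
  mul_mem' := by
    rintro g h ⟨hg, hg'⟩ ⟨hh, hh'⟩
    refine ⟨CircleAutGroup.mul_mem hg hh, fun i => ?_⟩
    simp [Equiv.Perm.mul_apply, hh' i, hg' i]
  inv_mem' := by
    rintro g ⟨hg, hg'⟩
    refine ⟨CircleAutGroup.inv_mem hg, fun i => ?_⟩
    conv_lhs => rw [← hg' i]
    simp

/-- The strict cyclic order induced by a linear order. -/
def CyclicLT {X : Type*} [LT X] (p q r : X) : Prop :=
  (p < q ∧ q < r) ∨ (q < r ∧ r < p) ∨ (r < p ∧ p < q)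

theorem StrictMono.cyclicLT_iff {X Y : Type*} [LinearOrder X] [Preorder Y] {f : X → Y}
    (hf : StrictMono f) {p q r : X} : CyclicLT (f p) (f q) (f r) ↔ CyclicLT p q r := by
  simp only [CyclicLT, hf.lt_iff_lt]

theorem IsBot.cyclicLT_iff {X : Type*} [PartialOrder X] {b : X} (hb : IsBot b) {p q : X} :
    CyclicLT b p q ↔ b < p ∧ p < q := by
  simp [CyclicLT, (hb _).not_gt]

/-- An injective map preserving the cyclic order of a linear order and fixing its least element
preserves the linear order. -/
theorem strictMono_of_cyclicLT {X : Type*} [LinearOrder X] {b : X} (hb : IsBot b) {f : X → X}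
    (hinj : Function.Injective f) (hfb : f b = b)
    (hf : ∀ p q r, CyclicLT p q r → CyclicLT (f p) (f q) (f r)) : StrictMono f := by
  intro p q hpq
  rcases (hb p).eq_or_lt with rfl | hp
  · rw [hfb]
    refine lt_of_le_of_ne (hb _) fun h => hpq.ne (hinj (hfb.trans h))
  · have := hf b p q (hb.cyclicLT_iff.2 ⟨hp, hpq⟩)
    rw [hfb, hb.cyclicLT_iff] at this
    exact this.2

/-- On a fundamental domain the cyclic order of the circle is induced by the linear order. -/
theorem sbtw'_coe_iff_s5 {c p q r : ℝ} (hp : p ∈ Set.Ico c (c + 1)) (hq : q ∈ Set.Ico c (c + 1))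
    (hr : r ∈ Set.Ico c (c + 1)) : Sbtw' (p : Circle') q r ↔ CyclicLT p q r := by
  obtain ⟨hp, hp'⟩ := hp
  obtain ⟨hq, hq'⟩ := hq
  obtain ⟨hr, hr'⟩ := hr
  constructor
  · rintro ⟨x, y, z, hx, hy, hz, hxy, hyz, hzx⟩
    have hlift {v w : ℝ} (h : (v : Circle') = w) : ∃ k : ℤ, v = w + k := by
      rw [← sub_eq_zero, ← AddCircle.coe_sub, AddCircle.coe_eq_zero_iff] at h
      obtain ⟨k, hk⟩ := h
      rw [zsmul_one] at hk
      exact ⟨k, by linarith⟩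
    obtain ⟨k, rfl⟩ := hlift hx
    obtain ⟨l, rfl⟩ := hlift hy
    obtain ⟨m, rfl⟩ := hlift hz
    have hkl : k < l + 1 := by exact_mod_cast (by linarith : (k : ℝ) < l + 1)
    have hlm : l < m + 1 := by exact_mod_cast (by linarith : (l : ℝ) < m + 1)
    have hmk : m < k + 2 := by exact_mod_cast (by linarith : (m : ℝ) < k + 2)
    obtain ⟨rfl, rfl⟩ | ⟨rfl, rfl⟩ | ⟨rfl, rfl⟩ :
        (l = k ∧ m = k) ∨ (l = k ∧ m = k + 1) ∨ (l = k + 1 ∧ m = k + 1) := by omega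
    · exact Or.inl ⟨by linarith, by linarith⟩
    · push_cast at *
      exact Or.inr (Or.inr ⟨by linarith, by linarith⟩)
    · push_cast at *
      exact Or.inr (Or.inl ⟨by linarith, by linarith⟩)
  · have hcoe (x : ℝ) : ((x - 1 : ℝ) : Circle') = x := by simp
    rintro (⟨h₁, h₂⟩ | ⟨h₁, h₂⟩ | ⟨h₁, h₂⟩)
    · exact ⟨p, q, r, rfl, rfl, rfl, h₁, h₂, by linarith⟩
    · exact ⟨p - 1, q, r, hcoe p, rfl, rfl, by linarith, h₁, by linarith⟩
    · exact ⟨p - 1, q - 1, r, hcoe p, hcoe q, rfl, by linarith, by linarith, by linarith⟩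

/-- A strictly increasing parametrization of `Ico a b` by `WithBot ℝ`. -/
theorem exists_strictMono_withBot_range_eq_Ico {a b : ℝ} (hab : a < b) :
    ∃ h : WithBot ℝ → ℝ, StrictMono h ∧ Set.range h = Set.Ico a b ∧ h ⊥ = a := by
  let u := orderIsoIooNegOneOne ℝ
  have hba : 0 < b - a := sub_pos.2 hab
  have hpos (x : ℝ) : 0 < (b - a) * (((u x : ℝ) + 1) / 2) := by
    have := (u x).2.1
    exact mul_pos hba (by linarith)
  refine ⟨fun x => x.recBotCoe a fun y => a + (b - a) * (((u y : ℝ) + 1) / 2), ?_, ?_, rfl⟩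
  · intro x y hxy
    induction y with
    | bot => simp at hxy
    | coe y =>
      induction x with
      | bot => simpa using hpos y
      | coe x =>
        have : (u x : ℝ) < u y := u.strictMono (WithBot.coe_lt_coe.1 hxy)
        change a + _ < a + _
        gcongr
  · ext r
    constructor
    · rintro ⟨x, rfl⟩
      induction x with
      | bot => exact ⟨le_rfl, hab⟩
      | coe x =>
        refine ⟨(lt_add_of_pos_right a (hpos x)).le, ?_⟩
        have := (u x).2.2
        change a + _ < b
        nlinarith
    · rintro ⟨h₁, h₂⟩
      rcases h₁.eq_or_lt with rfl | h₁
      · exact ⟨⊥, rfl⟩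
      · have hv : 2 * ((r - a) / (b - a)) - 1 ∈ Set.Ioo (-1 : ℝ) 1 := by
          have h₃ : 0 < (r - a) / (b - a) := div_pos (by linarith) hba
          have h₄ : (r - a) / (b - a) < 1 := (div_lt_one hba).2 (by linarith)
          constructor <;> linarith
        refine ⟨(u.symm ⟨_, hv⟩ : ℝ), ?_⟩
        change a + (b - a) * (((u (u.symm _) : ℝ) + 1) / 2) = r
        rw [u.apply_symm_apply]
        field_simp
        ring

/-- Concatenating parametrizations of the consecutive arcs cut out by a cyclically ordered tuple
identifies the circle with a lexicographic product. -/
theorem CyclicallyOrdered.exists_lex_equiv {n : ℕ} (hn : 1 ≤ n) {a : Fin n → Circle'}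
    (ha : CyclicallyOrdered a) : ∃ e : (Fin n ×ₗ WithBot ℝ) ≃ Circle',
      (∀ i, e (toLex (i, ⊥)) = a i) ∧
      ∀ p q r, Sbtw' (e p) (e q) (e r) ↔ CyclicLT p q r := by
  obtain ⟨t, hta, ht, htt⟩ := ha
  let i₀ : Fin n := ⟨0, hn⟩
  have hi₀ (i : Fin n) : i₀ ≤ i := Nat.zero_le _
  let u (i : Fin n) : ℝ := if h : i.1 + 1 < n then t ⟨i.1 + 1, h⟩ else t i₀ + 1
  have htu (i : Fin n) : t i < u i := by
    dsimp only [u]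
    split_ifs
    · exact ht (Nat.lt_succ_self i.1)
    · exact htt _ _
  have hut {i j : Fin n} (hij : i < j) : u i ≤ t j := by
    have h : i.1 + 1 < n := lt_of_le_of_lt hij j.2
    simp only [u, dif_pos h]
    exact ht.monotone hij
  have hu (i : Fin n) : u i ≤ t i₀ + 1 := by
    dsimp only [u]
    split_ifs
    · exact (htt _ _).le
    · exact le_rfl
  choose h hmono hrange hbot using fun i => exists_strictMono_withBot_range_eq_Ico (htu i)
  have hmem (i : Fin n) (x : WithBot ℝ) : h i x ∈ Set.Ico (t i) (u i) :=
    hrange i ▸ Set.mem_range_self x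
  let L (p : Fin n ×ₗ WithBot ℝ) : ℝ := h (ofLex p).1 (ofLex p).2
  have hL : StrictMono L := by
    intro p q hpq
    rcases Prod.Lex.lt_iff.1 hpq with hlt | ⟨heq, hlt⟩
    · exact ((hmem _ _).2.trans_le (hut hlt)).trans_le (hmem _ _).1
    · dsimp only [L]
      rw [heq]
      exact hmono _ hlt
  have hLmem (p) : L p ∈ Set.Ico (t i₀) (t i₀ + 1) :=
    ⟨(ht.monotone (hi₀ _)).trans (hmem _ _).1, (hmem _ _).2.trans_le (hu _)⟩
  have hLsurj {r : ℝ} (hr : r ∈ Set.Ico (t i₀) (t i₀ + 1)) : ∃ p, L p = r := by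
    obtain ⟨i, hi, hmax⟩ := (Finset.univ.filter fun i => t i ≤ r).exists_max_image id
      ⟨i₀, by simpa using hr.1⟩
    simp only [Finset.mem_filter, Finset.mem_univ, true_and, id] at hi hmax
    have hru : r < u i := by
      dsimp only [u]
      split_ifs with hlt
      · by_contra! hle
        exact absurd (hmax _ hle) (not_le.2 (Nat.lt_succ_self i.1))
      · exact hr.2
    obtain ⟨x, hx⟩ : r ∈ Set.range (h i) := hrange i ▸ ⟨hi, hru⟩
    exact ⟨toLex (i, x), hx⟩
  have : Fact ((0 : ℝ) < 1) := ⟨one_pos⟩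
  refine ⟨Equiv.ofBijective (fun p => (L p : Circle')) ⟨fun p q hpq => ?_, fun x => ?_⟩,
    fun i => ?_, fun p q r => ?_⟩
  · exact hL.injective ((AddCircle.coe_eq_coe_iff_of_mem_Ico (hLmem p) (hLmem q)).1 hpq)
  · obtain ⟨p, hp⟩ := hLsurj (AddCircle.equivIco 1 (t i₀) x).2
    refine ⟨p, ?_⟩
    change (L p : Circle') = x
    rw [hp]
    exact (AddCircle.equivIco 1 (t i₀)).symm_apply_apply x
  · change (h i ⊥ : Circle') = a i
    rw [hbot, hta]
  · exact (sbtw'_coe_iff_s5 (hLmem p) (hLmem q) (hLmem r)).trans hL.cyclicLT_iff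

/-- Families of automorphisms of `ℝ` act fibrewise on `ι ×ₗ WithBot ℝ`. -/
def fibrewisePerm (ι : Type*) : (ι → ℝ ≃o ℝ) →* Equiv.Perm (ι ×ₗ WithBot ℝ) where
  toFun F :=
    { toFun := fun p => toLex ((ofLex p).1, (ofLex p).2.map (F (ofLex p).1))
      invFun := fun p => toLex ((ofLex p).1, (ofLex p).2.map (F (ofLex p).1).symm)
      left_inv := fun p => congrArg (fun x => toLex ((ofLex p).1, x))
        ((F (ofLex p).1).toEquiv.withBotCongr.symm_apply_apply (ofLex p).2)
      right_inv := fun p => congrArg (fun x => toLex ((ofLex p).1, x))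
        ((F (ofLex p).1).toEquiv.withBotCongr.apply_symm_apply (ofLex p).2) }
  map_one' := by
    ext p : 1
    change toLex ((ofLex p).1, (ofLex p).2.map id) = p
    simp
  map_mul' F F' := by
    ext p : 1
    change _ = toLex ((ofLex p).1, ((ofLex p).2.map _).map _)
    rw [WithBot.map_map]
    rfl

theorem fibrewisePerm_apply {ι : Type*} (F : ι → ℝ ≃o ℝ) (i : ι) (x : WithBot ℝ) :
    fibrewisePerm ι F (toLex (i, x)) = toLex (i, x.map (F i)) :=
  rfl

theorem fibrewisePerm_injective (ι : Type*) : Function.Injective (fibrewisePerm ι) := by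
  intro F F' h
  ext i x
  have := congrArg (fun g => (ofLex (g (toLex (i, (x : WithBot ℝ))))).2) h
  exact WithBot.coe_injective this

theorem strictMono_fibrewisePerm {ι : Type*} [LinearOrder ι] (F : ι → ℝ ≃o ℝ) :
    StrictMono (fibrewisePerm ι F) := by
  intro p q hpq
  rcases Prod.Lex.lt_iff.1 hpq with hlt | ⟨heq, hlt⟩
  · exact Prod.Lex.lt_iff.2 (Or.inl hlt)
  · refine Prod.Lex.lt_iff.2 (Or.inr ⟨heq, ?_⟩)
    change (ofLex p).2.map (F (ofLex p).1) < (ofLex q).2.map (F (ofLex q).1)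
    rw [heq]
    exact (F _).strictMono.withBot_map hlt

/-- The fibrewise permutations are the increasing ones fixing the least point of each fibre. -/
theorem mem_range_fibrewisePerm_iff {ι : Type*} [LinearOrder ι]
    (f : Equiv.Perm (ι ×ₗ WithBot ℝ)) : f ∈ (fibrewisePerm ι).range ↔
      StrictMono f ∧ ∀ i, f (toLex (i, ⊥)) = toLex (i, ⊥) := by
  constructor
  · rintro ⟨F, rfl⟩
    exact ⟨strictMono_fibrewisePerm F, fun i => rfl⟩
  rintro ⟨hf, hfix⟩
  have key (g : Equiv.Perm (ι ×ₗ WithBot ℝ)) (hg : StrictMono g)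
      (hgfix : ∀ i, g (toLex (i, ⊥)) = toLex (i, ⊥)) (i : ι) (x : ℝ) :
      ∃ y : ℝ, g (toLex (i, (x : WithBot ℝ))) = toLex (i, (y : WithBot ℝ)) := by
    have h₁ : toLex (i, ⊥) < g (toLex (i, (x : WithBot ℝ))) := by
      rw [← hgfix i]
      exact hg (Prod.Lex.toLex_lt_toLex.2 (Or.inr ⟨rfl, WithBot.bot_lt_coe x⟩))
    obtain ⟨⟨j, y⟩, hjy⟩ := toLex.surjective (g (toLex (i, (x : WithBot ℝ))))
    rw [← hjy] at h₁
    rcases Prod.Lex.toLex_lt_toLex.1 h₁ with hij | ⟨hij, hy⟩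
    · have h₂ : g (toLex (i, (x : WithBot ℝ))) < g (toLex (j, ⊥)) :=
        hg (Prod.Lex.toLex_lt_toLex.2 (Or.inl hij))
      rw [← hjy, hgfix] at h₂
      simp [Prod.Lex.toLex_lt_toLex] at h₂
    · obtain rfl : i = j := hij
      obtain ⟨y, rfl⟩ := WithBot.ne_bot_iff_exists.1 hy.ne'
      exact ⟨y, hjy.symm⟩
  have hf' : StrictMono f.symm := fun p q hpq => by
    simpa using (hf.lt_iff_lt (a := f.symm p) (b := f.symm q)).1 (by simpa using hpq)
  have hfix' (i : ι) : f.symm (toLex (i, ⊥)) = toLex (i, ⊥) := by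
    rw [Equiv.symm_apply_eq, hfix]
  choose φ hφ using key f hf hfix
  choose ψ hψ using key f.symm hf' hfix'
  have coe_inj {i : ι} {x y : ℝ}
      (h : toLex (i, (x : WithBot ℝ)) = toLex (i, (y : WithBot ℝ))) : x = y := by
    simpa using h
  have hmono (i : ι) : StrictMono (φ i) := fun x y hxy => by
    have h : f (toLex (i, (x : WithBot ℝ))) < f (toLex (i, (y : WithBot ℝ))) :=
      hf (Prod.Lex.toLex_lt_toLex.2 (Or.inr ⟨rfl, WithBot.coe_lt_coe.2 hxy⟩))
    rw [hφ, hφ] at h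
    simpa [Prod.Lex.toLex_lt_toLex] using h
  have hright (i : ι) : Function.RightInverse (ψ i) (φ i) := fun x =>
    coe_inj (by rw [← hφ, ← hψ, Equiv.apply_symm_apply])
  refine ⟨fun i => (hmono i).orderIsoOfRightInverse (φ i) (ψ i) (hright i), ?_⟩
  ext p : 1
  obtain ⟨⟨i, x⟩, rfl⟩ := toLex.surjective p
  rw [fibrewisePerm_apply]
  induction x with
  | bot => exact (hfix i).symm
  | coe x => exact (hφ i x).symm

/-- For `n ≥ 1` and `a ∈ S^{{n}}`, the pointwise stabilizer `G(a)` is isomorphic,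
as a group, to the `n`-fold direct product of `H = (ℝ ≃o ℝ)`. -/
theorem pointwiseStab_iso_orderIso_pow
    (n : ℕ) (hn : 1 ≤ n) (a : Fin n → Circle') (ha : CyclicallyOrdered a) :
    Nonempty (PointwiseStab a ≃* (Fin n → ℝ ≃o ℝ)) := by
  obtain ⟨e, hea, he⟩ := ha.exists_lex_equiv hn
  let Φ : (Fin n → ℝ ≃o ℝ) →* Equiv.Perm Circle' :=
    e.permCongrHom.toMonoidHom.comp (fibrewisePerm (Fin n))
  have hΦ : Function.Injective Φ :=
    e.permCongrHom.injective.comp (fibrewisePerm_injective (Fin n))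
  have hbot : IsBot (toLex ((⟨0, hn⟩ : Fin n), (⊥ : WithBot ℝ))) := by
    intro p
    rcases (show (⟨0, hn⟩ : Fin n) ≤ (ofLex p).1 from Nat.zero_le _).lt_or_eq with h | h
    · exact Prod.Lex.le_iff.2 (Or.inl h)
    · exact Prod.Lex.le_iff.2 (Or.inr ⟨h, bot_le⟩)
  have hrange : Φ.range = PointwiseStab a := by
    ext g
    obtain ⟨f, rfl⟩ := e.permCongrHom.surjective g
    have hmem : e.permCongrHom f ∈ Φ.range ↔ f ∈ (fibrewisePerm (Fin n)).range := by
      constructor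
      · rintro ⟨F, hF⟩
        exact ⟨F, e.permCongrHom.injective hF⟩
      · rintro ⟨F, rfl⟩
        exact ⟨F, rfl⟩
    have happ (p) : e.permCongrHom f (e p) = e (f p) := by
      simp [Equiv.permCongrHom]
    have hcyc : PreservesCyclicOrder (e.permCongrHom f) ↔
        ∀ p q r, CyclicLT p q r ↔ CyclicLT (f p) (f q) (f r) := by
      simp only [PreservesCyclicOrder, e.surjective.forall, happ, he]
    have hfix : (∀ i, e.permCongrHom f (a i) = a i) ↔
        ∀ i, f (toLex (i, ⊥)) = toLex (i, ⊥) := by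
      simp only [← hea, happ, e.injective.eq_iff]
    rw [hmem, mem_range_fibrewisePerm_iff]
    change _ ↔ PreservesCyclicOrder _ ∧ ∀ i, _
    rw [hcyc, hfix]
    refine and_congr_left fun hb => ⟨fun hf p q r => hf.cyclicLT_iff.symm, fun hf => ?_⟩
    exact strictMono_of_cyclicLT hbot f.injective (hb _) fun p q r => (hf p q r).1
  exact ⟨((MonoidHom.ofInjective hΦ).trans (MulEquiv.subgroupCongr hrange)).symm⟩
end

section
/- Let ∞ = 0 ∈ S, let K = Stab_G(∞) be the stabilizer of ∞ in G, and fix a bijection ι : ℝ → S ∖ {∞} such that for all s, t ∈ ℝ, s < t if and only if sbtw(∞, ι(s), ι(t)). Fix n ≥ 1. For 0 ≤ i ≤ n−1 define α_i : ℝ^{(n)} → S^{{n}} by α_i(x) = σ^i(ι(x_1), …, ι(x_n)) and β_i : ℝ^{(n−1)} → S^{{n}} by β_i(x) = σ^i(ι(x_1), …, ι(x_{n−1}), ∞), where σ(y_1,…,y_n) = (y_n, y_1, …, y_{n−1}). Then the induced map from the disjoint union of n copies of ℝ^{(n)} and n copies of ℝ^{(n−1)} (indexed by i = 0, …, n−1)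 to S^{{n}} is a bijection; moreover it is equivariant for K, where k ∈ K acts on each copy of ℝ^{(m)} coordinatewise via ι^{-1} ∘ k ∘ ι, and on S^{{n}} diagonally. -/
/-- `α_i(x) = σ^i (ι x₁, …, ι x_{n+1})`, where `σ` is the cyclic shift
`σ(y₁,…,y_{n+1}) = (y_{n+1}, y₁, …, y_n)`. -/
def alphaMap (n : ℕ) (ι : ℝ → Circle') (i : Fin (n + 1)) (x : Fin (n + 1) → ℝ) :
    Fin (n + 1) → Circle' :=
  fun j => ι (x (j - i))

/-- `β_i(x) = σ^i (ι x₁, …, ι x_n, ∞)` where `∞ = 0 ∈ S`. -/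
noncomputable def betaMap (n : ℕ) (ι : ℝ → Circle') (i : Fin (n + 1)) (x : Fin n → ℝ) :
    Fin (n + 1) → Circle' :=
  fun j => if h : (j - i) = Fin.last n then 0 else ι (x ((j - i).castPred h))

/-- The map from the disjoint union of `n+1` copies of `ℝ^{(n+1)}` and `n+1`
copies of `ℝ^{(n)}` to `(n+1)`-tuples on the circle, given by the `α_i` and
`β_i`. -/
noncomputable def decompMap (n : ℕ) (ι : ℝ → Circle') :
    (Fin (n + 1) × {x : Fin (n + 1) → ℝ // StrictMono x}) ⊕
      (Fin (n + 1) × {x : Fin n → ℝ // StrictMono x}) → (Fin (n + 1) → Circle')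
  | .inl (i, x) => alphaMap n ι i x.1
  | .inr (i, x) => betaMap n ι i x.1

/-- Points of `(0, 1]` are determined by their class on the circle. -/
theorem eq_of_coe_eq_of_mem_Ioc {a b : ℝ} (ha : a ∈ Set.Ioc (0 : ℝ) 1)
    (hb : b ∈ Set.Ioc (0 : ℝ) 1) (h : (a : Circle') = b) : a = b :=
  (AddCircle.coe_eq_coe_iff_of_mem_Ioc (a := (0 : ℝ)) (by simpa using ha) (by simpa using hb)).1 h

theorem exists_mem_Ioc_coe_eq (y : Circle') : ∃ r ∈ Set.Ioc (0 : ℝ) 1, (r : Circle') = y := by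
  have hr := (AddCircle.equivIoc (1 : ℝ) 0 y).2
  exact ⟨AddCircle.equivIoc (1 : ℝ) 0 y, by simpa using hr,
    (AddCircle.equivIoc (1 : ℝ) 0).symm_apply_apply y⟩

theorem coe_circle_eq_coe_iff {a b : ℝ} :
    (a : Circle') = b ↔ ∃ m : ℤ, a = b + m := by
  rw [← sub_eq_zero, ← AddCircle.coe_sub, AddCircle.coe_eq_zero_iff]
  refine exists_congr fun m => ?_
  rw [zsmul_eq_mul, mul_one, eq_sub_iff_add_eq, add_comm, eq_comm]

theorem coe_circle_sub_intCast (a : ℝ) (m : ℤ) : ((a - m : ℝ) : Circle') = a :=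
  coe_circle_eq_coe_iff.2 ⟨-m, by push_cast; ring⟩

theorem coe_circle_one : ((1 : ℝ) : Circle') = 0 := AddCircle.coe_period 1

theorem coe_circle_ne_zero {v : ℝ} (hv : v ∈ Set.Ioo (0 : ℝ) 1) : (v : Circle') ≠ 0 := by
  rw [← coe_circle_one]
  intro h
  exact hv.2.ne (eq_of_coe_eq_of_mem_Ioc ⟨hv.1, hv.2.le⟩ ⟨one_pos, le_rfl⟩ h)

/-- An order-compatible parametrization of the circle minus `0` lifts to an increasing
parametrization of the interval `(0, 1)`. -/
theorem exists_strictMono_lift {ι : ℝ → Circle'} (hι_range : Set.range ι = {(0 : Circle')}ᶜ)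
    (hι_ord : ∀ s t : ℝ, s < t ↔ Sbtw' 0 (ι s) (ι t)) :
    ∃ φ : ℝ → ℝ, StrictMono φ ∧ Set.range φ = Set.Ioo 0 1 ∧ ∀ s, (φ s : Circle') = ι s := by
  choose r hr hry using exists_mem_Ioc_coe_eq
  have hlt : ∀ s, r (ι s) < 1 := fun s => (hr _).2.lt_of_ne fun h => by
    have h0 : ι s ∈ ({(0 : Circle')}ᶜ : Set Circle') := hι_range ▸ Set.mem_range_self s
    exact h0 (by rw [← hry (ι s), h, coe_circle_one]; rfl)
  refine ⟨fun s => r (ι s), fun s t hst => ?_, ?_, fun s => hry _⟩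
  · obtain ⟨a, b, c, ha, hb, hc, hab, hbc, hca⟩ := (hι_ord s t).1 hst
    obtain ⟨m, hm⟩ := coe_circle_eq_coe_iff.1 (show (a : Circle') = ((0 : ℝ) : Circle') from ha)
    have h1 : r (ι s) = b - m := eq_of_coe_eq_of_mem_Ioc (hr _)
      ⟨by linarith, by linarith⟩ (by rw [hry, coe_circle_sub_intCast, hb])
    have h2 : r (ι t) = c - m := eq_of_coe_eq_of_mem_Ioc (hr _)
      ⟨by linarith, by linarith⟩ (by rw [hry, coe_circle_sub_intCast, hc])
    simp only [h1, h2]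
    linarith
  · ext v
    refine ⟨?_, fun hv => ?_⟩
    · rintro ⟨s, rfl⟩
      exact ⟨(hr _).1, hlt s⟩
    · have h0 : (v : Circle') ∈ Set.range ι := hι_range ▸ coe_circle_ne_zero hv
      obtain ⟨s, hs⟩ := h0
      exact ⟨s, eq_of_coe_eq_of_mem_Ioc (hr _) ⟨hv.1, hv.2.le⟩ (by rw [hry, hs])⟩

/-- A cyclic rotation of a strictly increasing tuple determines both the tuple and the rotation. -/
theorem StrictMono.eq_of_rotate_eq {n : ℕ} {i i' : Fin (n + 1)} {u u' : Fin (n + 1) → ℝ}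
    (hu : StrictMono u) (hu' : StrictMono u') (h : ∀ j, u (j - i) = u' (j - i')) :
    i = i' ∧ u = u' := by
  have h1 := h i
  have h2 := h i'
  rw [sub_self] at h1 h2
  have h3 : u (i' - i) ≤ u 0 := by
    rw [h1, h2]
    exact hu'.monotone (Fin.zero_le _)
  have h4 : i' - i = 0 := Fin.le_zero_iff.1 (hu.le_iff_le.1 h3)
  obtain rfl : i = i' := (sub_eq_zero.1 h4).symm
  refine ⟨rfl, funext fun k => ?_⟩
  simpa using h (k + i)

theorem Fin.val_sub_eq_ite {n : ℕ} (j i : Fin (n + 1)) :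
    (j - i).val = if j < i then n + 1 + j.val - i.val else j.val - i.val := by
  split_ifs with h
  · exact Fin.coe_sub_iff_lt.2 h
  · exact Fin.coe_sub_iff_le.2 (not_lt.1 h)

/-- A tuple on the circle is cyclically ordered iff it is a rotation of the image of
an increasing tuple in `(0, 1]`. -/
theorem cyclicallyOrdered_iff_exists_rotate {n : ℕ} (y : Fin (n + 1) → Circle') :
    CyclicallyOrdered y ↔ ∃ (i : Fin (n + 1)) (u : Fin (n + 1) → ℝ), StrictMono u ∧
      (∀ k, u k ∈ Set.Ioc (0 : ℝ) 1) ∧ ∀ j, (u (j - i) : Circle') = y j := by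
  constructor
  · rintro ⟨t, hty, ht, ht1⟩
    choose r hr hry using fun j => exists_mem_Ioc_coe_eq (y j)
    choose m hm using fun j => coe_circle_eq_coe_iff.1 ((hty j).trans (hry j).symm)
    obtain ⟨i, hi⟩ := Finite.exists_min r
    have hge : ∀ j, i ≤ j → m j = m i := fun j hij => by
      have h1 := ht.monotone hij
      have h2 := ht1 j i
      have h3 := hi j
      have h4 := (hr j).2
      have h5 := (hr i).1
      rw [hm j, hm i] at h1 h2
      have h6 : (m j : ℝ) < m i + 1 := by linarith
      have h7 : (m i : ℝ) < m j + 1 := by linarith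
      norm_cast at h6 h7
      lia
    have hlt : ∀ j, j < i → m j = m i - 1 := fun j hij => by
      have h1 := ht hij
      have h2 := ht1 i j
      have h3 := hi j
      have h4 := (hr j).2
      have h5 := (hr i).1
      rw [hm j, hm i] at h1 h2
      have h6 : (m j : ℝ) < m i := by linarith
      have h7 : (m i : ℝ) < m j + 2 := by linarith
      norm_cast at h6 h7
      lia
    refine ⟨i, fun k => r (k + i), fun a b hab => ?_, fun k => hr _, fun j => ?_⟩
    · have key : ∀ j j' : Fin (n + 1), j - i < j' - i → r j < r j' := fun j j' hjj => by
        rw [Fin.lt_def, Fin.val_sub_eq_ite, Fin.val_sub_eq_ite] at hjj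
        have e := hm j
        have e' := hm j'
        have h1 := ht1 j j'
        by_cases hj : j < i <;> by_cases hj' : j' < i
        · have hlt' : j < j' := by simp only [hj, hj', if_true, Fin.lt_def] at *; lia
          have := ht hlt'
          rw [hlt j hj] at e
          rw [hlt j' hj'] at e'
          linarith
        · simp only [hj, hj', if_true, if_false] at hjj
          have := j'.2
          have := i.2
          lia
        · rw [hge j (not_lt.1 hj)] at e
          rw [hlt j' hj'] at e'
          push_cast at e'
          linarith
        · have hlt' : j < j' := by
            simp only [hj, hj', if_false] at hjj
            simp only [Fin.lt_def] at *
            lia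
          have := ht hlt'
          rw [hge j (not_lt.1 hj)] at e
          rw [hge j' (not_lt.1 hj')] at e'
          linarith
      exact key _ _ (by simpa using hab)
    · simp [hry]
  · rintro ⟨i, u, hu, hu1, huy⟩
    refine ⟨fun j => if j < i then u (j - i) - 1 else u (j - i), fun j => ?_, fun a b hab => ?_,
      fun a b => ?_⟩
    · rw [← huy]
      dsimp only
      split_ifs
      · simp
      · rfl
    · have key := @hu (a - i) (b - i)
      rw [Fin.lt_def, Fin.val_sub_eq_ite, Fin.val_sub_eq_ite] at key
      have h1 := hu1 (a - i)
      have h2 := hu1 (b - i)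
      simp only [Set.mem_Ioc] at h1 h2
      by_cases ha : a < i <;> by_cases hb : b < i
      · simp only [ha, hb, if_true] at key ⊢
        linarith [key (by simp only [Fin.lt_def] at *; lia)]
      · simp only [ha, hb, if_true, if_false]
        linarith
      · exact absurd (hab.trans hb) ha
      · simp only [ha, hb, if_false] at key ⊢
        exact key (by simp only [Fin.lt_def] at *; lia)
    · have key := @hu (a - i) (b - i)
      rw [Fin.lt_def, Fin.val_sub_eq_ite, Fin.val_sub_eq_ite] at key
      have h1 := hu1 (a - i)
      have h2 := hu1 (b - i)
      simp only [Set.mem_Ioc] at h1 h2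
      by_cases ha : a < i <;> by_cases hb : b < i
      · simp only [ha, hb, if_true]
        linarith
      · simp only [ha, hb, if_true, if_false]
        linarith
      · simp only [ha, hb, if_true, if_false] at key ⊢
        linarith [key (by have := a.2; have := i.2; lia)]
      · simp only [ha, hb, if_false]
        linarith

/-- The increasing tuple in `(0, 1]` underlying an element of the disjoint union: apply `φ`
coordinatewise, and append `1` on the second summand. -/
noncomputable def liftTuple (n : ℕ) (φ : ℝ → ℝ) :
    (Fin (n + 1) × {x : Fin (n + 1) → ℝ // StrictMono x}) ⊕
      (Fin (n + 1) × {x : Fin n → ℝ // StrictMono x}) → Fin (n + 1) × (Fin (n + 1) → ℝ)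
  | .inl (i, x) => (i, φ ∘ x.1)
  | .inr (i, x) => (i, Fin.snoc (α := fun _ => ℝ) (φ ∘ x.1) 1)

theorem coe_liftTuple {n : ℕ} {ι : ℝ → Circle'} {φ : ℝ → ℝ} (hφι : ∀ s, (φ s : Circle') = ι s)
    (p) (j : Fin (n + 1)) :
    (((liftTuple n φ p).2 (j - (liftTuple n φ p).1) : ℝ) : Circle') = decompMap n ι p j := by
  rcases p with ⟨i, x⟩ | ⟨i, x⟩
  · exact hφι _
  · simp only [liftTuple, decompMap, betaMap]
    generalize j - i = k
    induction k using Fin.lastCases with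
    | last => simp
    | cast k => simp [hφι]

theorem liftTuple_injective {n : ℕ} {φ : ℝ → ℝ} (hφ : StrictMono φ) (hφ1 : ∀ s, φ s < 1) :
    Function.Injective (liftTuple n φ) := by
  rintro (⟨i, x⟩ | ⟨i, x⟩) (⟨i', x'⟩ | ⟨i', x'⟩) h
  all_goals
    obtain ⟨rfl, h⟩ := Prod.ext_iff.1 h
    simp only [liftTuple] at h
  · rw [Subtype.ext (hφ.injective.comp_left h)]
    rfl
  · have := congrFun h (Fin.last n)
    simp only [Function.comp_apply, Fin.snoc_last] at this
    exact absurd this (hφ1 _).ne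
  · have := congrFun h (Fin.last n)
    simp only [Function.comp_apply, Fin.snoc_last] at this
    exact absurd this (hφ1 _).ne'
  · rw [Subtype.ext (hφ.injective.comp_left (Fin.snoc_injective2 h).1)]
    rfl

theorem range_liftTuple {n : ℕ} {φ : ℝ → ℝ} (hφ : StrictMono φ)
    (hφ_range : Set.range φ = Set.Ioo 0 1) :
    Set.range (liftTuple n φ) = {q | StrictMono q.2 ∧ ∀ k, q.2 k ∈ Set.Ioc (0 : ℝ) 1} := by
  have hmem : ∀ s, φ s ∈ Set.Ioo (0 : ℝ) 1 := fun s => hφ_range ▸ Set.mem_range_self s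
  ext ⟨i, u⟩
  constructor
  · rintro ⟨⟨i', x⟩ | ⟨i', x⟩, h⟩
    · rw [← h]
      exact ⟨hφ.comp x.2, fun k => Set.Ioo_subset_Ioc_self (hmem _)⟩
    · rw [← h]
      refine ⟨fun a b hab => ?_, fun k => ?_⟩
      · simp only [liftTuple]
        induction a using Fin.lastCases with
        | last => exact absurd hab (Fin.le_last b).not_gt
        | cast a =>
          induction b using Fin.lastCases with
          | last => simpa using (hmem _).2
          | cast b => simpa using hφ (x.2 (Fin.castSucc_lt_castSucc_iff.1 hab))
      · simp only [liftTuple]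
        induction k using Fin.lastCases with
        | last => simp
        | cast k => simpa using Set.Ioo_subset_Ioc_self (hmem (x.1 k))
  · rintro ⟨hu, hu1⟩
    dsimp only at hu hu1
    have hpre : ∀ v ∈ Set.Ioo (0 : ℝ) 1, ∃ s, φ s = v := fun v hv => by
      rwa [← hφ_range] at hv
    rcases (hu1 (Fin.last n)).2.lt_or_eq with hlast | hlast
    · choose x hx using fun k =>
        hpre (u k) ⟨(hu1 k).1, (hu.monotone (Fin.le_last k)).trans_lt hlast⟩
      refine ⟨.inl (i, ⟨x, fun a b hab => hφ.lt_iff_lt.1 ?_⟩), ?_⟩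
      · rw [hx, hx]
        exact hu hab
      · exact Prod.ext rfl (funext hx)
    · choose x hx using fun k : Fin n =>
        hpre (u k.castSucc) ⟨(hu1 _).1, hlast ▸ hu (Fin.castSucc_lt_last k)⟩
      refine ⟨.inr (i, ⟨x, fun a b hab => hφ.lt_iff_lt.1 ?_⟩), ?_⟩
      · rw [hx, hx]
        exact hu (Fin.castSucc_lt_castSucc_iff.2 hab)
      · refine Prod.ext rfl (funext fun k => ?_)
        simp only [liftTuple]
        induction k using Fin.lastCases with
        | last => simp [hlast]
        | cast k => simp [hx]

/-- Let `∞ = 0 ∈ S` and let `ι : ℝ → S ∖ {∞}` be a bijection with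
`s < t ↔ sbtw(∞, ι s, ι t)`. For `n + 1 ≥ 1`, the map induced by the `α_i` and
`β_i` (for `0 ≤ i ≤ n`) from the disjoint union of `n+1` copies of `ℝ^{(n+1)}`
and `n+1` copies of `ℝ^{(n)}` to `S^{{n+1}}` is a bijection: it is injective with
range exactly `S^{{n+1}}`. Moreover it is equivariant for the stabilizer `K` of
`∞` in `G`, acting on each copy of `ℝ^{(m)}` coordinatewise via `ι⁻¹ ∘ k ∘ ι`
and diagonally on `S^{{n+1}}`. -/
theorem decompMap_bijective_and_equivariant
    (n : ℕ) (ι : ℝ → Circle')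
    (hι_inj : Function.Injective ι)
    (hι_range : Set.range ι = {(0 : Circle')}ᶜ)
    (hι_ord : ∀ s t : ℝ, s < t ↔ Sbtw' 0 (ι s) (ι t)) :
    Function.Injective (decompMap n ι) ∧
    Set.range (decompMap n ι) = {y : Fin (n + 1) → Circle' | CyclicallyOrdered y} ∧
    ∀ g : Equiv.Perm Circle', PreservesCyclicOrder g → g 0 = 0 →
      (∀ (i : Fin (n + 1)) (x x' : {x : Fin (n + 1) → ℝ // StrictMono x}),
        (∀ j, ι (x'.1 j) = g (ι (x.1 j))) →
        decompMap n ι (.inl (i, x')) = fun j => g (decompMap n ι (.inl (i, x)) j)) ∧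
      (∀ (i : Fin (n + 1)) (x x' : {x : Fin n → ℝ // StrictMono x}),
        (∀ j, ι (x'.1 j) = g (ι (x.1 j))) →
        decompMap n ι (.inr (i, x')) = fun j => g (decompMap n ι (.inr (i, x)) j)) := by
  obtain ⟨φ, hφ, hφ_range, hφι⟩ := exists_strictMono_lift hι_range hι_ord
  have hlift := range_liftTuple (n := n) hφ hφ_range
  have hmem : ∀ p, liftTuple n φ p ∈
      {q | StrictMono q.2 ∧ ∀ k, q.2 k ∈ Set.Ioc (0 : ℝ) 1} :=
    fun p => hlift ▸ Set.mem_range_self p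
  have hφ1 : ∀ s, φ s < 1 := fun s => (hφ_range ▸ Set.mem_range_self s : φ s ∈ Set.Ioo 0 1).2
  refine ⟨fun p q hpq => ?_, ?_, fun g _ hg0 => ⟨fun i x x' h => ?_, fun i x x' h => ?_⟩⟩
  · have hrot := (hmem p).1.eq_of_rotate_eq (hmem q).1 fun j =>
      eq_of_coe_eq_of_mem_Ioc ((hmem p).2 _) ((hmem q).2 _)
        (by rw [coe_liftTuple hφι, coe_liftTuple hφι, hpq])
    exact liftTuple_injective hφ hφ1 (Prod.ext hrot.1 hrot.2)
  · ext y
    rw [Set.mem_ofPred_eq, cyclicallyOrdered_iff_exists_rotate]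
    constructor
    · rintro ⟨p, rfl⟩
      exact ⟨_, _, (hmem p).1, (hmem p).2, coe_liftTuple hφι p⟩
    · rintro ⟨i, u, hu, hu1, huy⟩
      obtain ⟨p, hp⟩ : (i, u) ∈ Set.range (liftTuple n φ) := hlift ▸ ⟨hu, hu1⟩
      refine ⟨p, funext fun j => ?_⟩
      rw [← coe_liftTuple hφι, hp, huy]
  · exact funext fun j => h _
  · funext j
    simp only [decompMap, betaMap]
    split_ifs
    · exact hg0.symm
    · exact h _
end

section
/- For all n, m ≥ 1, the circular Delannoy number satisfies C(n,m) = n · (D(n, m−1) + D(n−1, m−1)). -/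
/-- Rotate a based list of steps to start at its first upward step leaving height `0`, returning
the horizontal position of that step's source together with the rotated list; `acc` holds the
steps already passed. -/
def rotateToCrossing {n m : ℕ} :
    ZMod n → ZMod m → List (ℕ × ℕ) → List (ℕ × ℕ) → ZMod n × List (ℕ × ℕ)
  | x, _, acc, [] => (x, acc)
  | x, y, acc, s :: L =>
    if y = 0 ∧ s.2 = 1 then (x, s :: L ++ acc)
    else rotateToCrossing (x + (s.1 : ZMod n)) (y + (s.2 : ZMod m)) (acc ++ [s]) L

lemma IsDelannoyStep.snd_eq {p : ℕ × ℕ} (h : IsDelannoyStep p) : p.2 = 0 ∨ p.2 = 1 := by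
  rcases h with rfl | rfl | rfl <;> simp

lemma exists_cast_eq_of_pos {m : ℕ} (hm : 1 ≤ m) (y : ZMod m) :
    ∃ k : ℕ, 1 ≤ k ∧ k ≤ m ∧ (k : ZMod m) = y := by
  have : NeZero m := ⟨by lia⟩
  by_cases h : y = 0
  · exact ⟨m, hm, le_rfl, by simp [h]⟩
  · refine ⟨y.val, ?_, y.val_lt.le, by simp⟩
    have := (ZMod.val_ne_zero y).2 h
    lia

lemma eq_of_natCast_eq_zero {m k : ℕ} (hk : 1 ≤ k) (hkm : k ≤ m) (h : (k : ZMod m) = 0) :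
    k = m := by
  rw [ZMod.natCast_eq_zero_iff] at h
  exact le_antisymm hkm (Nat.le_of_dvd hk h)

lemma rotateToCrossing_append_singleton {n m : ℕ} (t : ℕ × ℕ) (L : List (ℕ × ℕ)) (x : ZMod n)
    (k : ℕ) (acc : List (ℕ × ℕ)) (hL : ∀ p ∈ L, IsDelannoyStep p) (hkm : k ≤ m)
    (hs : m < k + L.sum.2) :
    rotateToCrossing x (k : ZMod m) acc (L ++ [t]) =
      rotateToCrossing x (k : ZMod m) (t :: acc) L := by
  induction L generalizing x k acc with
  | nil => simp at hs; lia
  | cons s L ih =>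
    simp only [List.cons_append, rotateToCrossing]
    split_ifs with h
    · simp
    · have hs2 := (hL s (by simp)).snd_eq
      have hk : k + s.2 ≤ m := by
        rcases hs2 with h0 | h1
        · lia
        · have : k ≠ m := by rintro rfl; simp [h1] at h
          lia
      have := ih (x + (s.1 : ZMod n)) (k + s.2) (acc ++ [s]) (fun p hp => hL p (by simp [hp])) hk
        (by simp at hs; lia)
      simpa using this

lemma rotateToCrossing_append_of_le {n m : ℕ} (r L : List (ℕ × ℕ)) (x : ZMod n) (k : ℕ)
    (acc : List (ℕ × ℕ)) (hk : 1 ≤ k) (hs : k + L.sum.2 ≤ m) :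
    rotateToCrossing x (k : ZMod m) acc (L ++ r) =
      rotateToCrossing (x + (L.sum.1 : ZMod n)) ((k + L.sum.2 : ℕ) : ZMod m) (acc ++ L) r := by
  induction L generalizing x k acc with
  | nil => simp
  | cons s L ih =>
    simp only [List.sum_cons, Prod.snd_add] at hs
    have h : ¬ ((k : ZMod m) = 0 ∧ s.2 = 1) := fun ⟨h0, h1⟩ => by
      have := eq_of_natCast_eq_zero hk (by lia) h0
      lia
    simp only [List.cons_append, rotateToCrossing, if_neg h]
    have := ih (x + (s.1 : ZMod n)) (k + s.2) (acc ++ [s]) (by lia) (by lia)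
    simpa [add_assoc] using this

lemma exists_crossing {m : ℕ} (L : List (ℕ × ℕ)) (k : ℕ)
    (hL : ∀ p ∈ L, IsDelannoyStep p) (hkm : k ≤ m) (hs : m < k + L.sum.2) :
    ∃ A s B, L = A ++ s :: B ∧ s.2 = 1 ∧ k + A.sum.2 = m := by
  induction L generalizing k with
  | nil => simp at hs; lia
  | cons s L ih =>
    have hs2 := (hL s (by simp)).snd_eq
    by_cases h : k = m ∧ s.2 = 1
    · exact ⟨[], s, L, rfl, h.2, by simpa using h.1⟩
    · obtain ⟨A, t, B, rfl, ht, hA⟩ := ih (k + s.2) (fun p hp => hL p (by simp [hp])) (by lia)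
        (by simp at hs; lia)
      exact ⟨s :: A, t, B, rfl, ht, by simpa [add_assoc] using hA⟩

lemma rotateToCrossing_eq_of_loopRot {n m : ℕ} (hm : 1 ≤ m) {b₁ b₂ : BasedLoop n m}
    (h : LoopRot n m b₁ b₂) :
    rotateToCrossing b₁.1.1.1 b₁.1.1.2 [] b₁.1.2 =
      rotateToCrossing b₂.1.1.1 b₂.1.1.2 [] b₂.1.2 := by
  obtain ⟨⟨x, y⟩, s, L, h₁, h₂⟩ := h
  have hb := b₁.2
  rw [h₁] at hb
  rw [h₁, h₂]
  obtain ⟨hL, hsum⟩ := hb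
  simp only [List.sum_cons, Prod.ext_iff, Prod.fst_add, Prod.snd_add] at hsum
  simp only [Prod.mk_add_mk, rotateToCrossing]
  split_ifs with hy
  · obtain ⟨rfl, hs⟩ := hy
    have key := rotateToCrossing_append_of_le (m := m) [s] L (x + (s.1 : ZMod n)) 1 []
      le_rfl (by lia)
    have hx : (s.1 : ZMod n) + (L.sum.1 : ZMod n) = 0 := by
      rw [← Nat.cast_add, hsum.1, ZMod.natCast_self]
    have hm' : 1 + L.sum.2 = m := by lia
    rw [hm', add_assoc, hx] at key
    simp only [hs, Nat.cast_one, zero_add] at key ⊢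
    rw [key]
    simp [rotateToCrossing, hs]
  · obtain ⟨k, hk, hkm, rfl⟩ := exists_cast_eq_of_pos hm y
    have hs2 := (hL s (by simp)).snd_eq
    have hk' : k + s.2 ≤ m := by
      rcases hs2 with h0 | h1
      · lia
      · have : k ≠ m := by rintro rfl; simp [h1] at hy
        lia
    have := rotateToCrossing_append_singleton (m := m) s L (x + (s.1 : ZMod n)) (k + s.2) []
      (fun p hp => hL p (by simp [hp])) hk' (by lia)
    simpa using this.symm

lemma quot_mk_eq_of_rotate {n m : ℕ} (A B : List (ℕ × ℕ)) (b₁ b₂ : BasedLoop n m)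
    (h₁ : b₁.1.2 = A ++ B) (h₂ : b₂.1.2 = B ++ A)
    (hv : b₂.1.1 = b₁.1.1 + ((A.sum.1 : ZMod n), (A.sum.2 : ZMod m))) :
    Quot.mk (LoopRot n m) b₁ = Quot.mk (LoopRot n m) b₂ := by
  induction A generalizing B b₁ with
  | nil =>
    congr 1
    apply Subtype.ext
    apply Prod.ext
    · simp [hv]
    · simp [h₁, h₂]
  | cons s A ih =>
    let b : BasedLoop n m := ⟨(b₁.1.1 + ((s.1 : ZMod n), (s.2 : ZMod m)), A ++ (B ++ [s])), by
      have h := b₁.2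
      rw [h₁] at h
      refine ⟨fun p hp => h.1 p ?_, ?_⟩
      · simp at hp ⊢; tauto
      · refine Eq.trans ?_ h.2; simp; abel⟩
    refine (Quot.sound (b := b) ⟨b₁.1.1, s, A ++ B, Prod.ext rfl h₁, ?_⟩).trans
      (ih (B ++ [s]) b rfl (by simp [h₂]) ?_)
    · simp [b]
    · rw [hv]; simp [b, add_assoc]

instance DelannoyPath.finite (n m : ℕ) : Finite (DelannoyPath n m) := by
  let f : Fin 2 × Fin 2 → ℕ × ℕ := fun p => (p.1, p.2)
  refine Set.Finite.subset ((List.finite_length_le (Fin 2 × Fin 2) (n + m)).image (List.map f)) ?_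
  rintro L ⟨hL, hsum⟩
  have hlen : ∀ L : List (ℕ × ℕ), (∀ p ∈ L, IsDelannoyStep p) →
      L.length ≤ L.sum.1 + L.sum.2 := by
    intro L hL
    induction L with
    | nil => simp
    | cons s L ih =>
      have := ih fun p hp => hL p (by simp [hp])
      rcases hL s (by simp) with rfl | rfl | rfl <;> simp <;> lia
  have hr : L ∈ Set.range (List.map f) := by
    rw [Set.range_list_map]
    intro p hp
    rcases hL p hp with rfl | rfl | rfl
    · exact ⟨(1, 0), rfl⟩
    · exact ⟨(0, 1), rfl⟩
    · exact ⟨(1, 1), rfl⟩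
  obtain ⟨l, rfl⟩ := hr
  refine ⟨l, ?_, rfl⟩
  simpa [hsum] using hlen _ hL

/-- The based loop leaving height `0` at `x` with the step `s` and continuing along `p`. -/
def DelannoyPath.cons {n m a b : ℕ} (x : ZMod n) (s : ℕ × ℕ) (hs : IsDelannoyStep s)
    (p : DelannoyPath a b) (h : s + (a, b) = (n, m)) : BasedLoop n m :=
  ⟨((x, 0), s :: p.1), by simpa [hs] using p.2.1, by simpa [p.2.2] using h⟩

/-- The loop obtained from the horizontal position of its crossing of height `0`, the kind of
crossing step, and the path taken after it. -/
def loopOfCrossing (n m : ℕ) :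
    ZMod (n + 1) × (DelannoyPath (n + 1) m ⊕ DelannoyPath n m) → DelannoyLoop (n + 1) (m + 1)
  | (x, .inl p) => Quot.mk _ (p.cons x (0, 1) (.inr (.inl rfl)) (by simp [add_comm]))
  | (x, .inr p) => Quot.mk _ (p.cons x (1, 1) (.inr (.inr rfl)) (by simp [add_comm]))

lemma loopOfCrossing_injective (n m : ℕ) : Function.Injective (loopOfCrossing n m) := by
  let F : DelannoyLoop (n + 1) (m + 1) → ZMod (n + 1) × List (ℕ × ℕ) :=
    Quot.lift (fun b => rotateToCrossing b.1.1.1 b.1.1.2 [] b.1.2)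
      fun _ _ h => rotateToCrossing_eq_of_loopRot (by lia) h
  rintro ⟨x, p | p⟩ ⟨y, q | q⟩ h <;> replace h := congrArg F h <;>
    simp [F, loopOfCrossing, DelannoyPath.cons, rotateToCrossing] at h
  · rw [h.1, Subtype.ext h.2]
  · rw [h.1, Subtype.ext h.2]

lemma loopOfCrossing_surjective (n m : ℕ) : Function.Surjective (loopOfCrossing n m) := by
  intro q
  obtain ⟨b, rfl⟩ := Quot.exists_rep q
  obtain ⟨⟨⟨x, y⟩, L⟩, hL, hsum⟩ := b
  dsimp only at hL hsum
  obtain ⟨k, hk, hkm, rfl⟩ := exists_cast_eq_of_pos (by lia) y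
  obtain ⟨A, s, B, rfl, hs, hA⟩ := exists_crossing L k hL hkm (by rw [hsum]; dsimp only; lia)
  have hBA : ∀ p ∈ B ++ A, IsDelannoyStep p := fun p hp => hL p (by simp at hp ⊢; tauto)
  have hy : (k : ZMod (m + 1)) + (A.sum.2 : ZMod (m + 1)) = 0 := by
    rw [← Nat.cast_add, hA, ZMod.natCast_self]
  simp only [List.sum_append, List.sum_cons, Prod.ext_iff, Prod.fst_add, Prod.snd_add] at hsum
  rcases hL s (by simp) with rfl | rfl | rfl
  · simp at hs
  · refine ⟨(x + (A.sum.1 : ZMod (n + 1)), .inl ⟨B ++ A, hBA, ?_⟩), ?_⟩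
    · simp [Prod.ext_iff]; lia
    · exact (quot_mk_eq_of_rotate A _ _ _ rfl rfl (by simp [DelannoyPath.cons, hy])).symm
  · refine ⟨(x + (A.sum.1 : ZMod (n + 1)), .inr ⟨B ++ A, hBA, ?_⟩), ?_⟩
    · simp [Prod.ext_iff]; lia
    · exact (quot_mk_eq_of_rotate A _ _ _ rfl rfl (by simp [DelannoyPath.cons, hy])).symm

/-- For `n, m ≥ 1`, `C(n,m) = n · (D(n, m−1) + D(n−1, m−1))`. -/
theorem circularDelannoy_eq_mul_add (n m : ℕ) (hn : 1 ≤ n) (hm : 1 ≤ m) :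
    circularDelannoy n m =
      n * (delannoyNumber n (m - 1) + delannoyNumber (n - 1) (m - 1)) := by
  obtain ⟨n, rfl⟩ := Nat.exists_eq_add_of_le' hn
  obtain ⟨m, rfl⟩ := Nat.exists_eq_add_of_le' hm
  have := Nat.card_eq_of_bijective _
    ⟨loopOfCrossing_injective n m, loopOfCrossing_surjective n m⟩
  rw [circularDelannoy, ← this, Nat.card_prod, Nat.card_sum, Nat.card_zmod]
  rfl
end

section
/- For all n, m ≥ 1, the circular Delannoy number satisfies C(n,m) = Σ_{k=1}^{min(n,m)} (n choose k) · (m choose k) · k · 2^k. -/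
/-- The lists of Delannoy steps with sum `(a, b)`. -/
def delannoyPaths (a b : ℕ) : Set (List (ℕ × ℕ)) :=
  {L | (∀ p ∈ L, IsDelannoyStep p) ∧ L.sum = (a, b)}

/-- The sum `∑ k < N, (a choose k) (b choose k) 2 ^ k`, which is the Delannoy number of `(a, b)`
as soon as `a < N`. -/
def delannoySum (N a b : ℕ) : ℕ :=
  ∑ k ∈ Finset.range N, a.choose k * b.choose k * 2 ^ k

theorem delannoySum_succ_succ_add (N a b : ℕ) :
    delannoySum (N + 1) (a + 1) (b + 1) + 2 * (a.choose N * b.choose N * 2 ^ N) =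
      delannoySum (N + 1) a (b + 1) + delannoySum (N + 1) (a + 1) b +
        delannoySum (N + 1) a b := by
  induction N with
  | zero => simp [delannoySum]
  | succ N ih =>
    unfold delannoySum at ih ⊢
    rw [Finset.sum_range_succ, Finset.sum_range_succ _ (N + 1),
      Finset.sum_range_succ _ (N + 1), Finset.sum_range_succ _ (N + 1)]
    simp only [Nat.choose_succ_succ', pow_succ] at ih ⊢
    linarith

theorem delannoySum_add_delannoySum (N p q : ℕ) :
    (∑ k ∈ Finset.range N, (p + 1).choose (k + 1) * q.choose k * 2 ^ (k + 1)) +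
        2 * (p.choose N * q.choose N * 2 ^ N) =
      delannoySum (N + 1) p (q + 1) + delannoySum (N + 1) p q := by
  induction N with
  | zero => simp [delannoySum]
  | succ N ih =>
    unfold delannoySum at ih ⊢
    rw [Finset.sum_range_succ, Finset.sum_range_succ _ (N + 1),
      Finset.sum_range_succ _ (N + 1)]
    simp only [Nat.choose_succ_succ', pow_succ] at ih ⊢
    linarith

theorem delannoyPaths_zero_zero : delannoyPaths 0 0 = {[]} := by
  ext L
  rcases L with _ | ⟨s, L⟩
  · simp [delannoyPaths, Prod.ext_iff]
  · simp only [delannoyPaths, IsDelannoyStep, Set.mem_ofPred_eq, List.forall_mem_cons,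
      List.sum_cons, Prod.ext_iff, Prod.fst_add, Prod.snd_add, Set.mem_singleton_iff,
      reduceCtorEq, iff_false]
    omega

theorem delannoyPaths_zero_succ (b : ℕ) :
    delannoyPaths 0 (b + 1) = List.cons (0, 1) '' delannoyPaths 0 b := by
  ext L
  rcases L with _ | ⟨⟨x, y⟩, L⟩
  · simp [delannoyPaths, Prod.ext_iff]
  · simp only [delannoyPaths, IsDelannoyStep, Set.mem_ofPred_eq, List.forall_mem_cons,
      List.sum_cons, Set.mem_image, List.cons.injEq, Prod.ext_iff, Prod.fst_add, Prod.snd_add]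
    constructor
    · rintro ⟨⟨h, h'⟩, h1, h2⟩
      exact ⟨L, ⟨h', by omega, by omega⟩, by omega, rfl⟩
    · rintro ⟨L, ⟨h, h1, h2⟩, h3, rfl⟩
      exact ⟨⟨by omega, h⟩, by omega, by omega⟩

theorem delannoyPaths_succ_zero (a : ℕ) :
    delannoyPaths (a + 1) 0 = List.cons (1, 0) '' delannoyPaths a 0 := by
  ext L
  rcases L with _ | ⟨⟨x, y⟩, L⟩
  · simp [delannoyPaths, Prod.ext_iff]
  · simp only [delannoyPaths, IsDelannoyStep, Set.mem_ofPred_eq, List.forall_mem_cons,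
      List.sum_cons, Set.mem_image, List.cons.injEq, Prod.ext_iff, Prod.fst_add, Prod.snd_add]
    constructor
    · rintro ⟨⟨h, h'⟩, h1, h2⟩
      exact ⟨L, ⟨h', by omega, by omega⟩, by omega, rfl⟩
    · rintro ⟨L, ⟨h, h1, h2⟩, h3, rfl⟩
      exact ⟨⟨by omega, h⟩, by omega, by omega⟩

/-- The Delannoy paths to `(a, b)` whose first step increases the first coordinate. -/
def xHeadPaths (a b : ℕ) : Set (List (ℕ × ℕ)) :=
  {L | L ∈ delannoyPaths a b ∧ ∃ s T, L = s :: T ∧ s.1 = 1}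

theorem xHeadPaths_succ_succ (a b : ℕ) :
    xHeadPaths (a + 1) (b + 1) =
      List.cons (1, 0) '' delannoyPaths a (b + 1) ∪ List.cons (1, 1) '' delannoyPaths a b := by
  ext L
  rcases L with _ | ⟨⟨x, y⟩, L⟩
  · simp [xHeadPaths]
  · simp only [xHeadPaths, delannoyPaths, IsDelannoyStep, Set.mem_ofPred_eq,
      List.forall_mem_cons, List.sum_cons, Set.mem_image, Set.mem_union, List.cons.injEq,
      Prod.ext_iff, Prod.fst_add, Prod.snd_add]
    constructor
    · rintro ⟨⟨⟨h, h'⟩, h1, h2⟩, s, T, ⟨⟨h3, h4⟩, rfl⟩, h5⟩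
      rcases h with h | h | h
      · exact Or.inl ⟨L, ⟨h', by omega, by omega⟩, by omega, rfl⟩
      · omega
      · exact Or.inr ⟨L, ⟨h', by omega, by omega⟩, by omega, rfl⟩
    · rintro (⟨L, ⟨h, h1, h2⟩, h3, rfl⟩ | ⟨L, ⟨h, h1, h2⟩, h3, rfl⟩) <;>
        exact ⟨⟨⟨by omega, h⟩, by omega, by omega⟩, (x, y), L, ⟨⟨rfl, rfl⟩, rfl⟩, h3.1.symm⟩

theorem delannoyPaths_succ_succ (a b : ℕ) :
    delannoyPaths (a + 1) (b + 1) =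
      xHeadPaths (a + 1) (b + 1) ∪ List.cons (0, 1) '' delannoyPaths (a + 1) b := by
  ext L
  rcases L with _ | ⟨⟨x, y⟩, L⟩
  · simp [xHeadPaths, delannoyPaths, Prod.ext_iff]
  · simp only [xHeadPaths, delannoyPaths, IsDelannoyStep, Set.mem_ofPred_eq,
      List.forall_mem_cons, List.sum_cons, Set.mem_image, Set.mem_union, List.cons.injEq,
      Prod.ext_iff, Prod.fst_add, Prod.snd_add]
    constructor
    · rintro ⟨⟨h, h'⟩, h1, h2⟩
      by_cases hx : x = 1
      · exact Or.inl ⟨⟨⟨h, h'⟩, h1, h2⟩, (x, y), L, ⟨⟨rfl, rfl⟩, rfl⟩, hx⟩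
      · exact Or.inr ⟨L, ⟨h', by omega, by omega⟩, by omega, rfl⟩
    · rintro (⟨h, -⟩ | ⟨L, ⟨h, h1, h2⟩, h3, rfl⟩)
      · exact h
      · exact ⟨⟨by omega, h⟩, by omega, by omega⟩

theorem encard_image_cons {α : Type*} (s : α) (A : Set (List α)) :
    (List.cons s '' A).encard = A.encard :=
  (List.cons_injective).encard_image A

theorem encard_xHeadPaths_succ_succ (a b : ℕ) :
    (xHeadPaths (a + 1) (b + 1)).encard =
      (delannoyPaths a (b + 1)).encard + (delannoyPaths a b).encard := by
  rw [xHeadPaths_succ_succ, Set.encard_union_eq, encard_image_cons, encard_image_cons]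
  rw [Set.disjoint_left]
  rintro _ ⟨L, -, rfl⟩ ⟨L', -, h⟩
  simp at h

theorem encard_delannoyPaths {N a : ℕ} (b : ℕ) (h : a ≤ N) :
    (delannoyPaths a b).encard = delannoySum (N + 1) a b := by
  induction a generalizing b with
  | zero =>
    have key : delannoySum (N + 1) 0 b = 1 := by
      simp [delannoySum, Finset.sum_range_succ']
    rw [key]
    clear key
    induction b with
    | zero => simp [delannoyPaths_zero_zero]
    | succ b ih => rw [delannoyPaths_zero_succ, encard_image_cons, ih]
  | succ a iha =>
    induction b with
    | zero =>
      rw [delannoyPaths_succ_zero, encard_image_cons, iha _ (by omega)]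
      simp [delannoySum, Finset.sum_range_succ']
    | succ b ihb =>
      have hsum := delannoySum_succ_succ_add N a b
      rw [Nat.choose_eq_zero_of_lt (show a < N by omega)] at hsum
      rw [delannoyPaths_succ_succ, Set.encard_union_eq, encard_image_cons,
        encard_xHeadPaths_succ_succ, ihb, iha _ (by omega), iha _ (by omega)]
      · norm_cast
        linarith
      · rw [Set.disjoint_left]
        rintro _ ⟨-, s, T, rfl, hs⟩ ⟨L, -, h⟩
        simp only [List.cons.injEq] at h
        simp [← h.1] at hs

/-- A based loop is anchored if its basepoint has first coordinate `0` and its first step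
increases the first coordinate. -/
def BasedLoop.IsAnchored {n m : ℕ} (b : BasedLoop n m) : Prop :=
  b.1.1.1 = 0 ∧ ∃ s T, b.1.2 = s :: T ∧ s.1 = 1

/-- `b.RotatesTo c` means that `c` arises from `b` by moving a proper initial segment of
the steps to the end. -/
def BasedLoop.RotatesTo {n m : ℕ} (b c : BasedLoop n m) : Prop :=
  ∃ P S : List (ℕ × ℕ), S ≠ [] ∧ b.1.2 = P ++ S ∧ c.1.2 = S ++ P ∧
    c.1.1 = b.1.1 + ((P.sum.1 : ZMod n), (P.sum.2 : ZMod m))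

namespace BasedLoop

variable {n m : ℕ}

theorem RotatesTo.mk_eq {b c : BasedLoop n m} (h : b.RotatesTo c) :
    Quot.mk (LoopRot n m) b = Quot.mk (LoopRot n m) c := by
  obtain ⟨P, S, hS, hb, hc, hv⟩ := h
  induction P generalizing b S with
  | nil =>
    congr 1
    apply Subtype.ext
    apply Prod.ext
    · simpa [Prod.mk_zero_zero] using hv.symm
    · simp [hb, hc]
  | cons s P ih =>
    obtain ⟨⟨v, L⟩, hL⟩ := b
    simp only at hb hv
    subst hb
    let b' : BasedLoop n m := ⟨(v + ((s.1 : ZMod n), (s.2 : ZMod m)), P ++ S ++ [s]), by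
      refine ⟨fun p hp => hL.1 p ?_, ?_⟩
      · simp at hp ⊢; tauto
      · rw [← hL.2]
        simp only [List.sum_append, List.sum_cons, List.cons_append, List.sum_nil]
        abel⟩
    have hr : LoopRot n m ⟨(v, s :: P ++ S), hL⟩ b' := ⟨v, s, P ++ S, rfl, rfl⟩
    rw [Quot.sound hr]
    refine ih (S ++ [s]) (by simp) ?_ ?_ ?_
    · simp [b']
    · simp [hc]
    · rw [hv]
      simp only [b', List.sum_cons, Prod.fst_add, Prod.snd_add, Nat.cast_add]
      rw [add_assoc]
      rfl

theorem RotatesTo.of_loopRot {b b' c : BasedLoop n m} (hr : LoopRot n m b b')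
    (h : b.RotatesTo c) : b'.RotatesTo c := by
  obtain ⟨v, s, L, hb, hb'⟩ := hr
  obtain ⟨P, S, -, h1, h2, h3⟩ := h
  rw [hb] at h1 h3
  rcases P with _ | ⟨p, P⟩
  · simp only [List.nil_append] at h1
    subst h1
    have hsum := b.2.2
    rw [hb] at hsum
    simp only [List.sum_cons] at hsum
    refine ⟨L, [s], by simp, by rw [hb'], by simpa using h2, ?_⟩
    rw [h3, hb', add_assoc]
    congr 1
    have e1 := congrArg (fun p : ℕ × ℕ => ((p.1 : ZMod n), (p.2 : ZMod m))) hsum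
    simp only [Prod.fst_add, Prod.snd_add, Nat.cast_add, CharP.cast_eq_zero] at e1
    simpa using e1.symm
  · simp only [List.cons_append, List.cons.injEq] at h1
    obtain ⟨rfl, rfl⟩ := h1
    refine ⟨P, S ++ [s], by simp, by simp [hb'], by simp [h2], ?_⟩
    rw [h3, hb', add_assoc]
    simp

theorem exists_append_cons_of_lt_sum {L : List (ℕ × ℕ)} (hL : ∀ p ∈ L, IsDelannoyStep p)
    {r : ℕ} (hr : r < L.sum.1) :
    ∃ P s S, L = P ++ s :: S ∧ P.sum.1 = r ∧ s.1 = 1 := by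
  induction L generalizing r with
  | nil => simp at hr
  | cons s L ih =>
    rw [List.forall_mem_cons] at hL
    simp only [List.sum_cons, Prod.fst_add] at hr
    have hs : s.1 = 0 ∨ s.1 = 1 := by
      rcases hL.1 with h | h | h <;> simp [h]
    by_cases h0 : s.1 = 1 ∧ r = 0
    · exact ⟨[], s, L, rfl, by simp [h0.2], h0.1⟩
    · obtain ⟨P, t, S, rfl, h2, h3⟩ := ih hL.2 (r := r - s.1) (by omega)
      refine ⟨s :: P, t, S, rfl, ?_, h3⟩
      simp only [List.sum_cons, Prod.fst_add]
      omega

theorem exists_rotatesTo_isAnchored (hn : 1 ≤ n) (b : BasedLoop n m) :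
    ∃ c : BasedLoop n m, c.IsAnchored ∧ b.RotatesTo c := by
  have : NeZero n := ⟨by omega⟩
  obtain ⟨⟨v, L⟩, hL, hsum⟩ := b
  simp only at hL hsum
  obtain ⟨P, s, S, rfl, h2, h3⟩ := exists_append_cons_of_lt_sum hL (r := (-v.1).val)
    (by rw [hsum]; exact ZMod.val_lt _)
  refine ⟨⟨(v + ((P.sum.1 : ZMod n), (P.sum.2 : ZMod m)), s :: S ++ P), ?_, ?_⟩,
    ⟨?_, s, S ++ P, rfl, h3⟩, P, s :: S, by simp, rfl, rfl, rfl⟩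
  · intro p hp
    apply hL
    simp at hp ⊢; tauto
  · rw [← hsum, List.sum_append, List.sum_append, add_comm]
  · simp [h2]

theorem IsAnchored.eq_of_split {b c c' : BasedLoop n m} (hc : c.IsAnchored)
    (hc' : c'.IsAnchored) {P Q S : List (ℕ × ℕ)} (hS : S ≠ []) (hb : b.1.2 = P ++ Q ++ S)
    (hcL : c.1.2 = Q ++ S ++ P) (hcL' : c'.1.2 = S ++ (P ++ Q))
    (hcv : c.1.1 = b.1.1 + ((P.sum.1 : ZMod n), (P.sum.2 : ZMod m)))
    (hcv' : c'.1.1 = b.1.1 + (((P ++ Q).sum.1 : ZMod n), ((P ++ Q).sum.2 : ZMod m))) :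
    c = c' := by
  rcases Q with _ | ⟨q, Q⟩
  · apply Subtype.ext
    apply Prod.ext
    · simp [hcv, hcv']
    · simp [hcL, hcL']
  · exfalso
    obtain ⟨t, S, rfl⟩ := List.exists_cons_of_ne_nil hS
    obtain ⟨h0, s, T, hs, hs1⟩ := hc
    obtain ⟨h0', s', T', hs', hs1'⟩ := hc'
    rw [hcL, List.cons_append, List.cons_append, List.cons.injEq] at hs
    rw [hcL', List.cons_append, List.cons.injEq] at hs'
    have hsum := congrArg Prod.fst b.2.2
    rw [hcv] at h0
    rw [hcv'] at h0'
    simp only [hb, List.sum_append, List.sum_cons, Prod.fst_add, hs.1, hs'.1, hs1, hs1']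
      at hsum
    simp only [List.sum_append, Prod.fst_add, Nat.cast_add] at h0 h0'
    rw [← add_assoc, h0, zero_add, ZMod.natCast_eq_zero_iff, List.sum_cons, Prod.fst_add,
      hs.1, hs1] at h0'
    have := Nat.le_of_dvd (by omega) h0'
    omega

theorem RotatesTo.unique {b c c' : BasedLoop n m} (h : b.RotatesTo c) (h' : b.RotatesTo c')
    (hc : c.IsAnchored) (hc' : c'.IsAnchored) : c = c' := by
  obtain ⟨P, S, hS, hb, hcL, hcv⟩ := h
  obtain ⟨P', S', hS', hb', hcL', hcv'⟩ := h'
  rcases List.append_eq_append_iff.1 (hb.symm.trans hb') with ⟨Q, rfl, rfl⟩ | ⟨Q, rfl, rfl⟩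
  · exact hc.eq_of_split hc' hS' hb' hcL hcL' hcv hcv'
  · exact (hc'.eq_of_split hc hS hb hcL' hcL hcv' hcv).symm

theorem RotatesTo.refl_of_isAnchored {c : BasedLoop n m} (hc : c.IsAnchored) :
    c.RotatesTo c := by
  obtain ⟨-, s, T, h, -⟩ := hc
  exact ⟨[], c.1.2, by simp [h], by simp, by simp, by simp⟩

/-- The unique anchored based loop in the rotation class of a based loop. -/
noncomputable def anchor (hn : 1 ≤ n) (b : BasedLoop n m) : BasedLoop n m :=
  (b.exists_rotatesTo_isAnchored hn).choose

theorem isAnchored_anchor (hn : 1 ≤ n) (b : BasedLoop n m) : (b.anchor hn).IsAnchored :=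
  (b.exists_rotatesTo_isAnchored hn).choose_spec.1

theorem rotatesTo_anchor (hn : 1 ≤ n) (b : BasedLoop n m) : b.RotatesTo (b.anchor hn) :=
  (b.exists_rotatesTo_isAnchored hn).choose_spec.2

theorem anchor_eq_of_loopRot (hn : 1 ≤ n) {b b' : BasedLoop n m} (h : LoopRot n m b b') :
    b.anchor hn = b'.anchor hn :=
  ((b.rotatesTo_anchor hn).of_loopRot h).unique (b'.rotatesTo_anchor hn)
    (b.isAnchored_anchor hn) (b'.isAnchored_anchor hn)

theorem IsAnchored.anchor_eq (hn : 1 ≤ n) {c : BasedLoop n m} (hc : c.IsAnchored) :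
    c.anchor hn = c :=
  (c.rotatesTo_anchor hn).unique (RotatesTo.refl_of_isAnchored hc) (c.isAnchored_anchor hn) hc

end BasedLoop

theorem circularDelannoy_eq_mul (n m : ℕ) (hn : 1 ≤ n) :
    circularDelannoy n m = m * (xHeadPaths n m).ncard := by
  have hcard : Nat.card (DelannoyLoop n m) = Nat.card {b : BasedLoop n m // b.IsAnchored} := by
    symm
    refine Nat.card_congr (Equiv.ofBijective
      (fun c => (Quot.mk (LoopRot n m) c.1 : DelannoyLoop n m)) ⟨?_, ?_⟩)
    · intro c c' h
      have h := congrArg (Quot.lift (BasedLoop.anchor hn)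
        fun _ _ => BasedLoop.anchor_eq_of_loopRot hn) h
      simp only [c.2.anchor_eq, c'.2.anchor_eq] at h
      exact Subtype.ext h
    · intro q
      induction q using Quot.ind with
      | mk b =>
        exact ⟨⟨b.anchor hn, b.isAnchored_anchor hn⟩, (b.rotatesTo_anchor hn).mk_eq.symm⟩
  let e : {b : BasedLoop n m // b.IsAnchored} ≃ ZMod m × xHeadPaths n m :=
    { toFun := fun b => (b.1.1.1.2, ⟨b.1.1.2, b.1.2, b.2.2⟩)
      invFun := fun p => ⟨⟨((0, p.1), p.2.1), p.2.2.1⟩, rfl, p.2.2.2⟩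
      left_inv := by
        rintro ⟨⟨⟨⟨x, y⟩, L⟩, h⟩, h0, h1⟩
        simp only at h0
        subst h0
        rfl
      right_inv := fun _ => rfl }
  rw [circularDelannoy, hcard, Nat.card_congr e, Nat.card_prod, Nat.card_zmod]
  rfl

/-- For `n, m ≥ 1`, `C(n,m) = Σ_{k=1}^{min(n,m)} (n choose k)(m choose k) k 2^k`. -/
theorem circularDelannoy_sum_formula (n m : ℕ) (hn : 1 ≤ n) (hm : 1 ≤ m) :
    circularDelannoy n m =
      ∑ k ∈ Finset.Icc 1 (min n m), n.choose k * m.choose k * k * 2 ^ k := by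
  obtain ⟨p, rfl⟩ := Nat.exists_eq_add_of_le' hn
  obtain ⟨q, rfl⟩ := Nat.exists_eq_add_of_le' hm
  have hx : (xHeadPaths (p + 1) (q + 1)).ncard =
      ∑ k ∈ Finset.range (p + 1), (p + 1).choose (k + 1) * q.choose k * 2 ^ (k + 1) := by
    have h := delannoySum_add_delannoySum (p + 1) p q
    rw [Nat.choose_succ_self] at h
    rw [Set.ncard, encard_xHeadPaths_succ_succ, encard_delannoyPaths _ p.le_succ,
      encard_delannoyPaths _ p.le_succ, ← Nat.cast_add, ENat.toNat_natCast, ← h]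
    simp
  rw [circularDelannoy_eq_mul _ _ hn, hx, Finset.mul_sum]
  trans ∑ k ∈ Finset.Icc 1 (p + 1), (p + 1).choose k * (q + 1).choose k * k * 2 ^ k
  · rw [Finset.range_eq_Ico, ← Finset.Ico_add_one_right_eq_Icc,
      ← Finset.sum_Ico_add' _ 0 (p + 1) 1]
    refine Finset.sum_congr rfl fun k _ => ?_
    linear_combination (p + 1).choose (k + 1) * 2 ^ (k + 1) * Nat.add_one_mul_choose_eq q k
  · symm
    refine Finset.sum_subset (Finset.Icc_subset_Icc_right (min_le_left _ _)) fun k hk hk' => ?_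
    rw [Finset.mem_Icc] at hk hk'
    rw [Nat.choose_eq_zero_of_lt (show q + 1 < k by omega)]
    simp
end

section
/- In the ring of formal power series in two variables X, Y over ℤ, let F = Σ_{n,m ≥ 1} C(n,m) X^n Y^m. Then (1 − X − Y − X·Y)^2 · F = 2·X·Y. -/
open Function in
/-- If every point of a finite type is periodic under `f`, the orbits of `f` are counted by
weighting each point with the inverse of its minimal period. -/
theorem card_quot_eq_sum_inv_minimalPeriod {α : Type*} [Fintype α] (f : α → α)
    (hf : ∀ x, 0 < minimalPeriod f x) :
    (Nat.card (Quot fun x y => f x = y) : ℚ) = ∑ x, (minimalPeriod f x : ℚ)⁻¹ := by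
  classical
  set r : α → α → Prop := fun x y => f x = y
  have iterate_mk (x : α) (k : ℕ) : Quot.mk r (f^[k] x) = Quot.mk r x := by
    induction k with
    | zero => rfl
    | succ k ih =>
      rw [iterate_succ_apply', ← ih]
      exact (Quot.sound (r := r) rfl).symm
  have exists_iterate {x y : α} (h : Relation.EqvGen r x y) : ∃ k, f^[k] x = y := by
    induction h with
    | rel x y h => exact ⟨1, h⟩
    | refl x => exact ⟨0, rfl⟩
    | symm x y h ih =>
      obtain ⟨k, rfl⟩ := ih
      refine ⟨minimalPeriod f x * k - k, ?_⟩
      rw [← iterate_add_apply, Nat.sub_add_cancel (Nat.le_mul_of_pos_left k (hf x))]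
      exact (isPeriodicPt_minimalPeriod f x).mul_const k
    | trans x y z h₁ h₂ ih₁ ih₂ =>
      obtain ⟨k, rfl⟩ := ih₁
      obtain ⟨l, rfl⟩ := ih₂
      exact ⟨l + k, iterate_add_apply f l k x⟩
  have : Finite (Quot r) := Quot.finite r
  have : Fintype (Quot r) := Fintype.ofFinite _
  rw [← Finset.sum_fiberwise _ (Quot.mk r), Nat.card_eq_fintype_card, ← Finset.card_univ,
    Finset.cast_card]
  refine Finset.sum_congr rfl fun q _ => ?_
  obtain ⟨x, rfl⟩ := q.exists_rep
  have orbit : Finset.univ.filter (fun y => Quot.mk r y = Quot.mk r x) =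
      (Finset.range (minimalPeriod f x)).image fun k => f^[k] x := by
    ext y
    simp only [Finset.mem_filter, Finset.mem_univ, true_and, Finset.mem_image, Finset.mem_range]
    constructor
    · intro h
      obtain ⟨k, rfl⟩ := exists_iterate (Quot.eqvGen_exact h.symm)
      exact ⟨k % minimalPeriod f x, Nat.mod_lt _ (hf x), iterate_mod_minimalPeriod_eq⟩
    · rintro ⟨k, -, rfl⟩
      exact iterate_mk x k
  rw [orbit, Finset.sum_image]
  · have : ∀ k ∈ Finset.range (minimalPeriod f x),
        (minimalPeriod f (f^[k] x) : ℚ)⁻¹ = (minimalPeriod f x : ℚ)⁻¹ := fun k _ => by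
      rw [minimalPeriod_apply_iterate (minimalPeriod_pos_iff_mem_periodicPts.1 (hf x))]
    rw [Finset.sum_congr rfl this, Finset.sum_const, Finset.card_range, nsmul_eq_mul,
      mul_inv_cancel₀ (by exact_mod_cast (hf x).ne')]
  · intro i hi j hj h
    exact iterate_injOn_Iio_minimalPeriod (by simpa using hi) (by simpa using hj) h

namespace BasedLoop

variable {n m : ℕ}

/-- Move the basepoint of a loop along its first step. -/
def rotate (b : BasedLoop n m) : BasedLoop n m :=
  ⟨(b.1.1 + ((b.1.2.headI.1 : ZMod n), (b.1.2.headI.2 : ZMod m)), b.1.2.rotate 1),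
    fun p hp => b.2.1 p (List.mem_rotate.1 hp),
    ((List.rotate_perm _ _).sum_eq).trans b.2.2⟩

theorem coe_rotate (b : BasedLoop n m) : b.rotate.1 =
    (b.1.1 + ((b.1.2.headI.1 : ZMod n), (b.1.2.headI.2 : ZMod m)), b.1.2.rotate 1) := rfl

theorem ne_nil (hn : 1 ≤ n) (b : BasedLoop n m) : b.1.2 ≠ [] := by
  intro h
  have := b.2.2
  simp only [h, List.sum_nil, Prod.ext_iff, Prod.fst_zero] at this
  omega

theorem loopRot_iff (hn : 1 ≤ n) (b c : BasedLoop n m) : LoopRot n m b c ↔ b.rotate = c := by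
  constructor
  · rintro ⟨v, s, L, hb, hc⟩
    apply Subtype.ext
    simp [rotate, hb, hc]
  · rintro rfl
    obtain ⟨s, L, h⟩ := List.exists_cons_of_ne_nil (b.ne_nil hn)
    exact ⟨b.1.1, s, L, by rw [← h], by simp [rotate, h]⟩

theorem coe_iterate_rotate (b : BasedLoop n m) {r : ℕ} (hr : r ≤ b.1.2.length) :
    (rotate^[r] b).1 = (b.1.1 + (((b.1.2.take r).sum.1 : ZMod n), ((b.1.2.take r).sum.2 : ZMod m)),
      b.1.2.rotate r) := by
  induction r with
  | zero => simp [Prod.ext_iff]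
  | succ r ih =>
    have head : (b.1.2.rotate r).headI = b.1.2[r] := by
      rw [List.rotate_eq_drop_append_take (by omega), List.drop_eq_getElem_cons (by omega)]
      rfl
    rw [Function.iterate_succ_apply', coe_rotate, ih (by omega)]
    simp only [head, List.rotate_rotate, List.sum_take_succ _ _ hr]
    simp [add_assoc]

theorem minimalPeriod_rotate (hn : 1 ≤ n) (hm : 1 ≤ m) (b : BasedLoop n m) :
    Function.minimalPeriod rotate b = b.1.2.length := by
  have hpos : 0 < b.1.2.length := List.length_pos_iff.2 (b.ne_nil hn)
  have hper : Function.IsPeriodicPt rotate b.1.2.length b := by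
    apply Subtype.ext
    rw [coe_iterate_rotate b le_rfl, List.take_length, b.2.2]
    simp [Prod.ext_iff]
  refine le_antisymm (hper.minimalPeriod_le hpos) ?_
  by_contra! hlt
  have hr : 0 < Function.minimalPeriod rotate b := hper.minimalPeriod_pos hpos
  have hfix := congrArg Subtype.val (Function.isPeriodicPt_minimalPeriod rotate b).eq
  generalize Function.minimalPeriod rotate b = r at hlt hr hfix
  rw [coe_iterate_rotate b hlt.le, List.rotate_eq_drop_append_take hlt.le] at hfix
  obtain ⟨hv, hL⟩ := Prod.ext_iff.1 hfix
  simp only [add_eq_left, Prod.ext_iff, Prod.fst_zero, Prod.snd_zero,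
    ZMod.natCast_eq_zero_iff] at hv hL
  have hsteps := b.2.1
  have hsum := b.2.2
  rw [← List.take_append_drop r b.1.2] at hsteps hsum
  obtain ⟨s, T, hT⟩ := List.exists_cons_of_ne_nil
    (l := b.1.2.take r) (List.length_pos_iff.1 (by rw [List.length_take]; omega))
  obtain ⟨t, D, hD⟩ := List.exists_cons_of_ne_nil
    (l := b.1.2.drop r) (List.length_pos_iff.1 (by rw [List.length_drop]; omega))
  have hst : t = s := by
    have := hL.trans (List.take_append_drop r b.1.2).symm
    rw [hT, hD] at this
    exact (List.cons.inj this).1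
  subst hst
  rw [hT] at hv
  rw [hT, hD] at hsteps hsum
  have ht := hsteps t (by simp)
  simp only [List.cons_append, List.sum_cons, List.sum_append, Prod.ext_iff, Prod.fst_add,
    Prod.snd_add] at hv hsum
  obtain ⟨⟨x, hx⟩, ⟨y, hy⟩⟩ := hv
  have hx1 : x = 0 ∨ x = 1 := by
    have : n * x ≤ n * 1 := by omega
    have := Nat.le_of_mul_le_mul_left this hn
    omega
  have hy1 : y = 0 ∨ y = 1 := by
    have : m * y ≤ m * 1 := by omega
    have := Nat.le_of_mul_le_mul_left this hm
    omega
  rcases ht with rfl | rfl | rfl <;> rcases hx1 with rfl | rfl <;> rcases hy1 with rfl | rfl <;>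
    simp only [mul_zero, mul_one] at * <;> omega

end BasedLoop

/-- The lists of `l` Delannoy steps. -/
def delannoyLists : ℕ → Finset (List (ℕ × ℕ))
  | 0 => {[]}
  | l + 1 => (({(1, 0), (0, 1), (1, 1)} : Finset (ℕ × ℕ)) ×ˢ delannoyLists l).image
      fun p => p.1 :: p.2

theorem mem_delannoyLists {l : ℕ} {L : List (ℕ × ℕ)} :
    L ∈ delannoyLists l ↔ (∀ p ∈ L, IsDelannoyStep p) ∧ L.length = l := by
  induction l generalizing L with
  | zero => simp +contextual [delannoyLists, List.length_eq_zero_iff]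
  | succ l ih =>
    cases L with
    | nil => simp [delannoyLists]
    | cons s L =>
      simp only [delannoyLists, Finset.mem_image, Finset.mem_product, Finset.mem_insert,
        Finset.mem_singleton, ih, Prod.exists, List.cons.injEq, List.forall_mem_cons,
        List.length_cons, Nat.add_right_cancel_iff]
      constructor
      · rintro ⟨a, b, K, ⟨hs, hK, hl⟩, rfl, rfl⟩
        exact ⟨⟨hs, hK⟩, hl⟩
      · rintro ⟨⟨hs, hK⟩, hl⟩
        exact ⟨s.1, s.2, L, ⟨hs, hK, hl⟩, rfl, rfl⟩

theorem length_le_of_forall_isDelannoyStep {L : List (ℕ × ℕ)} (h : ∀ p ∈ L, IsDelannoyStep p) :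
    L.length ≤ L.sum.1 + L.sum.2 := by
  induction L with
  | nil => simp
  | cons s L ih =>
    have := ih fun p hp => h p (List.mem_cons_of_mem _ hp)
    have hs := h s List.mem_cons_self
    simp only [List.length_cons, List.sum_cons, Prod.fst_add, Prod.snd_add]
    rcases hs with rfl | rfl | rfl <;> simp only <;> omega

/-- The number of lists of `l` Delannoy steps with sum `p`. -/
def delannoyCount (l : ℕ) (p : ℕ × ℕ) : ℕ :=
  ((delannoyLists l).filter fun L => L.sum = p).card

theorem circularDelannoy_eq_sum {n m : ℕ} (hn : 1 ≤ n) (hm : 1 ≤ m) {N : ℕ} (hN : n + m < N) :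
    (circularDelannoy n m : ℚ) =
      ∑ l ∈ Finset.range N, (n * m * delannoyCount l (n, m) : ℚ) * (l : ℚ)⁻¹ := by
  classical
  have : NeZero n := ⟨by omega⟩
  have : NeZero m := ⟨by omega⟩
  let W : Finset ((ZMod n × ZMod m) × List (ℕ × ℕ)) := Finset.univ ×ˢ
    (Finset.range N).biUnion fun l => (delannoyLists l).filter fun L => L.sum = (n, m)
  have hW (b) : b ∈ W ↔ (∀ p ∈ b.2, IsDelannoyStep p) ∧ b.2.sum = (n, m) := by
    simp only [W, Finset.mem_product, Finset.mem_univ, true_and, Finset.mem_biUnion,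
      Finset.mem_range, Finset.mem_filter, mem_delannoyLists]
    constructor
    · rintro ⟨l, -, ⟨h, -⟩, hs⟩
      exact ⟨h, hs⟩
    · rintro ⟨h, hs⟩
      have := length_le_of_forall_isDelannoyStep h
      rw [hs] at this
      exact ⟨_, this.trans_lt hN, ⟨h, rfl⟩, hs⟩
  have : Fintype (BasedLoop n m) := Fintype.subtype W hW
  have hrot : LoopRot n m = fun b c => b.rotate = c := by
    ext b c
    exact BasedLoop.loopRot_iff hn b c
  rw [circularDelannoy, DelannoyLoop, hrot, card_quot_eq_sum_inv_minimalPeriod]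
  swap
  · intro b
    rw [BasedLoop.minimalPeriod_rotate hn hm]
    exact List.length_pos_iff.2 (b.ne_nil hn)
  simp only [BasedLoop.minimalPeriod_rotate hn hm]
  refine (Finset.sum_subtype W hW fun b => (b.2.length : ℚ)⁻¹).symm.trans ?_
  simp only [W, Finset.sum_product]
  rw [Finset.sum_const, Finset.sum_biUnion, Finset.smul_sum]
  · refine Finset.sum_congr rfl fun l _ => ?_
    rw [Finset.sum_congr rfl (g := fun _ => (l : ℚ)⁻¹)]
    · simp [delannoyCount, ZMod.card, mul_assoc]
    · intro L hL
      rw [(mem_delannoyLists.1 (Finset.mem_filter.1 hL).1).2]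
  · intro i _ j _ hij
    refine Finset.disjoint_left.2 fun L hi hj => hij ?_
    rw [← (mem_delannoyLists.1 (Finset.mem_filter.1 hi).1).2,
      (mem_delannoyLists.1 (Finset.mem_filter.1 hj).1).2]

namespace MvPowerSeries

variable {σ R : Type*} [CommRing R]

/-- The Euler operator `Xᵢ ∂/∂Xᵢ`. -/
def euler (i : σ) (f : MvPowerSeries σ R) : MvPowerSeries σ R :=
  fun d => (d i : R) * coeff d f

theorem coeff_euler (i : σ) (d : σ →₀ ℕ) (f : MvPowerSeries σ R) :
    coeff d (euler i f) = (d i : R) * coeff d f := rfl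

theorem euler_add (i : σ) (f g : MvPowerSeries σ R) : euler i (f + g) = euler i f + euler i g := by
  ext d
  simp [coeff_euler, mul_add]

theorem euler_mul (i : σ) (f g : MvPowerSeries σ R) :
    euler i (f * g) = euler i f * g + f * euler i g := by
  classical
  ext d
  simp only [map_add, coeff_euler, coeff_mul, Finset.mul_sum, ← Finset.sum_add_distrib]
  refine Finset.sum_congr rfl fun p hp => ?_
  rw [← Finset.HasAntidiagonal.mem_antidiagonal.1 hp, Finsupp.add_apply]
  push_cast
  ring

theorem euler_one (i : σ) : euler i (1 : MvPowerSeries σ R) = 0 := by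
  classical
  ext d
  rw [coeff_euler, coeff_one]
  split_ifs with h <;> simp [h]

theorem euler_pow (i : σ) (f : MvPowerSeries σ R) (k : ℕ) :
    euler i (f ^ (k + 1)) = (k + 1) * f ^ k * euler i f := by
  induction k with
  | zero => simp
  | succ k ih =>
    rw [pow_succ, euler_mul, ih]
    push_cast
    ring

theorem euler_natCast (i : σ) (k : ℕ) : euler i (k : MvPowerSeries σ R) = 0 := by
  induction k with
  | zero => ext; simp [coeff_euler]
  | succ k ih => rw [Nat.cast_succ, euler_add, ih, euler_one, add_zero]

theorem euler_X_self (i : σ) : euler i (X i : MvPowerSeries σ R) = X i := by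
  classical
  ext d
  rw [coeff_euler, coeff_X]
  split_ifs with h <;> simp [h]

theorem euler_X_of_ne {i j : σ} (hij : i ≠ j) : euler i (X j : MvPowerSeries σ R) = 0 := by
  classical
  ext d
  rw [coeff_euler, coeff_X]
  split_ifs with h <;> simp [h, hij]

theorem coeff_pow_mul_eq_zero {f g : MvPowerSeries σ R} (hf : constantCoeff f = 0) {d : σ →₀ ℕ}
    {k : ℕ} (hk : d.degree < k) : coeff d (f ^ k * g) = 0 := by
  apply coeff_of_lt_order
  calc (d.degree : ℕ∞) < k := by exact_mod_cast hk
    _ ≤ k • f.order := by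
      rw [nsmul_eq_mul]
      exact le_mul_of_one_le_right' (one_le_order_iff_constCoeff_eq_zero.2 hf)
    _ ≤ (f ^ k).order := le_order_pow k
    _ ≤ (f ^ k).order + g.order := le_self_add
    _ ≤ (f ^ k * g).order := le_order_mul

end MvPowerSeries

open MvPowerSeries

/-- The generating function `X + Y + XY` of a single Delannoy step. -/
noncomputable def delannoyStepSeries : MvPowerSeries (Fin 2) ℤ := X 0 + X 1 + X 0 * X 1

theorem coeff_delannoyStepSeries_pow (l : ℕ) (d : Fin 2 →₀ ℕ) :
    coeff d (delannoyStepSeries ^ l) = delannoyCount l (d 0, d 1) := by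
  classical
  let e (p : ℕ × ℕ) : Fin 2 →₀ ℕ := Finsupp.single 0 p.1 + Finsupp.single 1 p.2
  have e_add (p q : ℕ × ℕ) : e (p + q) = e p + e q := by
    simp only [e, Prod.fst_add, Prod.snd_add, Finsupp.single_add]
    abel
  have hP : delannoyStepSeries =
      ∑ s ∈ ({(1, 0), (0, 1), (1, 1)} : Finset (ℕ × ℕ)), monomial (e s) (1 : ℤ) := by
    rw [Finset.sum_insert (by decide), Finset.sum_insert (by decide), Finset.sum_singleton]
    simp [e, delannoyStepSeries, X, monomial_mul_monomial, add_assoc]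
  have hpow : delannoyStepSeries ^ l =
      ∑ L ∈ delannoyLists l, monomial (e L.sum) (1 : ℤ) := by
    induction l with
    | zero => simp [delannoyLists, e, monomial_zero_eq_C]
    | succ l ih =>
      rw [pow_succ', ih, delannoyLists, Finset.sum_image, Finset.sum_product, hP,
        Finset.sum_mul_sum]
      · simp [e_add, monomial_mul_monomial]
      · rintro ⟨_, _⟩ _ ⟨_, _⟩ _ h
        simpa using h
  have he (p : ℕ × ℕ) : d = e p ↔ p = (d 0, d 1) := by
    simp [e, Finsupp.ext_iff, Fin.forall_fin_two, Prod.ext_iff, eq_comm]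
  simp [hpow, coeff_monomial, he, delannoyCount]

theorem euler_euler_delannoyStepSeries_pow (k : ℕ) :
    euler 0 (euler 1 (delannoyStepSeries ^ (k + 1))) = ((k + 1 : ℕ) : MvPowerSeries (Fin 2) ℤ) *
      (X 0 * X 1 * ((k : MvPowerSeries (Fin 2) ℤ) * delannoyStepSeries ^ (k - 1) +
        ((k : MvPowerSeries (Fin 2) ℤ) + 1) * delannoyStepSeries ^ k)) := by
  have h₀ : euler 0 delannoyStepSeries = X 0 * (1 + X 1) := by
    simp only [delannoyStepSeries, euler_add, euler_mul, euler_X_self,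
      euler_X_of_ne (R := ℤ) (zero_ne_one (α := Fin 2))]
    ring
  have h₁ : euler 1 delannoyStepSeries = X 1 * (1 + X 0) := by
    simp only [delannoyStepSeries, euler_add, euler_mul, euler_X_self,
      euler_X_of_ne (R := ℤ) (one_ne_zero (α := Fin 2))]
    ring
  have h₂ : euler 0 (X 1 * (1 + X 0) : MvPowerSeries (Fin 2) ℤ) = X 0 * X 1 := by
    simp only [euler_add, euler_mul, euler_X_self, euler_one,
      euler_X_of_ne (R := ℤ) (zero_ne_one (α := Fin 2))]
    ring
  rw [euler_pow, ← Nat.cast_succ, h₁, mul_assoc, euler_mul, euler_natCast, euler_mul, h₂]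
  cases k with
  | zero => simp [euler_one]
  | succ k =>
    rw [euler_pow, h₀, Nat.add_sub_cancel, pow_succ]
    have h₃ : (1 + X 0) * (1 + X 1) = 1 + delannoyStepSeries := by
      rw [delannoyStepSeries]
      ring
    push_cast
    linear_combination ((k : MvPowerSeries (Fin 2) ℤ) + 1 + 1) * (k + 1) *
      delannoyStepSeries ^ k * X 0 * X 1 * h₃

theorem one_sub_sq_mul_sum {R : Type*} [CommRing R] (p : R) (N : ℕ) :
    (1 - p) ^ 2 * ∑ k ∈ Finset.range (N + 1), ((k : R) * p ^ (k - 1) + (k + 1) * p ^ k) =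
      2 + p ^ N * (2 * N * p - 2 * (N + 1) + (N + 1) * (1 - p) ^ 2) := by
  induction N with
  | zero => simp
  | succ N ih =>
    rw [Finset.sum_range_succ, mul_add, ih, Nat.add_sub_cancel]
    push_cast
    ring

theorem circularDelannoy_eq_coeff (d : Fin 2 →₀ ℕ) (h₀ : 1 ≤ d 0) (h₁ : 1 ≤ d 1) {N : ℕ}
    (hN : d.degree < N) :
    (circularDelannoy (d 0) (d 1) : ℤ) = coeff d (X 0 * X 1 * ∑ k ∈ Finset.range N,
      ((k : MvPowerSeries (Fin 2) ℤ) * delannoyStepSeries ^ (k - 1) +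
        (k + 1) * delannoyStepSeries ^ k)) := by
  rw [Finsupp.degree_eq_sum, Fin.sum_univ_two] at hN
  apply Int.cast_injective (α := ℚ)
  rw [Int.cast_natCast, circularDelannoy_eq_sum h₀ h₁ (hN.trans N.lt_succ_self),
    Finset.sum_range_succ', Finset.mul_sum, map_sum, Int.cast_sum]
  simp only [Nat.cast_zero, inv_zero, mul_zero, add_zero]
  refine Finset.sum_congr rfl fun k _ => ?_
  have h := congrArg (coeff d) (euler_euler_delannoyStepSeries_pow k)
  rw [coeff_euler, coeff_euler, coeff_delannoyStepSeries_pow, ← nsmul_eq_mul (k + 1), map_nsmul,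
    nsmul_eq_mul] at h
  have h' := congrArg (Int.cast : ℤ → ℚ) h
  have hk : ((k + 1 : ℕ) : ℚ) ≠ 0 := by positivity
  rw [mul_inv_eq_iff_eq_mul₀ hk, mul_comm _ ((k + 1 : ℕ) : ℚ), mul_assoc]
  exact_mod_cast h'

open MvPowerSeries in
/-- The generating function of the circular Delannoy numbers:
`F = Σ_{n,m ≥ 1} C(n,m) Xⁿ Yᵐ` satisfies `(1 − X − Y − XY)² · F = 2XY`
in `ℤ⟦X, Y⟧`. -/
theorem circularDelannoy_generating_function :
    let X : MvPowerSeries (Fin 2) ℤ := MvPowerSeries.X 0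
    let Y : MvPowerSeries (Fin 2) ℤ := MvPowerSeries.X 1
    let F : MvPowerSeries (Fin 2) ℤ :=
      fun d : Fin 2 →₀ ℕ =>
        if 1 ≤ d 0 ∧ 1 ≤ d 1 then (circularDelannoy (d 0) (d 1) : ℤ) else 0
    (1 - X - Y - X * Y) ^ 2 * F = 2 * X * Y := by
  intro X Y F
  set P := delannoyStepSeries
  have hP : 1 - X - Y - X * Y = 1 - P := by
    simp only [P, delannoyStepSeries, X, Y]
    ring
  have hP₀ : constantCoeff P = 0 := by
    simp [P, delannoyStepSeries]
  have hU : (1 - P) * invOfUnit (1 - P) 1 = 1 := mul_invOfUnit _ _ (by simp [hP₀])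
  set U := invOfUnit (1 - P) 1
  have hU2 : (1 - P) ^ 2 * U ^ 2 = 1 := by rw [← mul_pow, hU, one_pow]
  suffices hF : F = 2 * X * Y * U ^ 2 by
    rw [hP, hF]
    linear_combination 2 * X * Y * hU2
  ext d
  change (if 1 ≤ d 0 ∧ 1 ≤ d 1 then (circularDelannoy (d 0) (d 1) : ℤ) else 0) = _
  split_ifs with hd
  · have hsum := one_sub_sq_mul_sum P (d.degree + 1)
    rw [circularDelannoy_eq_coeff d hd.1 hd.2 (N := d.degree + 1 + 1) (by omega)]
    change coeff d (X * Y * _) = _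
    generalize ∑ k ∈ Finset.range (d.degree + 1 + 1), ((k : MvPowerSeries (Fin 2) ℤ) *
      P ^ (k - 1) + (k + 1) * P ^ k) = S at hsum ⊢
    obtain ⟨R, hR⟩ : ∃ R, (1 - P) ^ 2 * S = 2 + P ^ (d.degree + 1) * R := ⟨_, hsum⟩
    have hS : X * Y * S = 2 * X * Y * U ^ 2 + P ^ (d.degree + 1) * (X * Y * U ^ 2 * R) := by
      linear_combination X * Y * U ^ 2 * hR - X * Y * S * hU2
    rw [hS, map_add, coeff_pow_mul_eq_zero hP₀ (Nat.lt_succ_self _), add_zero]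
  · rcases not_and_or.1 hd with h | h
    · have hX : X ∣ 2 * X * Y * U ^ 2 := ⟨2 * Y * U ^ 2, by ring⟩
      exact (X_dvd_iff.1 hX d (by omega)).symm
    · have hY : Y ∣ 2 * X * Y * U ^ 2 := ⟨2 * X * U ^ 2, by ring⟩
      exact (X_dvd_iff.1 hY d (by omega)).symm
end

section
/- For n, m ≥ 1, the action of ZMod n on the set of (n,m)-Delannoy loops given by c · [(v, s)] = [(v + (c, 0), s)] is well-defined and free: if c · ℓ = ℓ for some Delannoy loop ℓ, then c = 0. -/
/-- The sum of the first `k` letters of the periodic infinite word obtained by repeating `s`. -/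
def cyclicPartialSum : ℕ → List (ℕ × ℕ) → ℕ × ℕ
  | 0, _ => 0
  | k + 1, s => s.headD 0 + cyclicPartialSum k (s.rotate 1)

theorem cyclicPartialSum_add (a b : ℕ) (s : List (ℕ × ℕ)) :
    cyclicPartialSum (a + b) s = cyclicPartialSum a s + cyclicPartialSum b (s.rotate a) := by
  induction a generalizing s with
  | zero => simp [cyclicPartialSum]
  | succ a ih =>
    rw [Nat.add_right_comm, cyclicPartialSum, ih, cyclicPartialSum, List.rotate_rotate,
      add_assoc, Nat.add_comm 1 a]

theorem cyclicPartialSum_length_append (s t : List (ℕ × ℕ)) :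
    cyclicPartialSum s.length (s ++ t) = s.sum := by
  induction s generalizing t with
  | nil => rfl
  | cons x s ih => simp [cyclicPartialSum, ih]

theorem cyclicPartialSum_length (s : List (ℕ × ℕ)) :
    cyclicPartialSum s.length s = s.sum := by
  simpa using cyclicPartialSum_length_append s []

theorem rotate_mul_of_rotate_eq {s : List (ℕ × ℕ)} {j : ℕ} (h : s.rotate j = s) (i : ℕ) :
    s.rotate (i * j) = s := by
  induction i with
  | zero => simp
  | succ i ih => rw [Nat.succ_mul, ← List.rotate_rotate, ih, h]

theorem cyclicPartialSum_mul_of_rotate_eq {s : List (ℕ × ℕ)} {j : ℕ} (h : s.rotate j = s)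
    (i : ℕ) : cyclicPartialSum (i * j) s = i • cyclicPartialSum j s := by
  induction i with
  | zero => simp [cyclicPartialSum]
  | succ i ih =>
    rw [Nat.succ_mul, cyclicPartialSum_add, ih, rotate_mul_of_rotate_eq h, succ_nsmul]

/-- `b₂` is obtained from `b₁` by moving the basepoint forward along `k` steps. -/
def BasedLoop.IsIteratedRot {n m : ℕ} (k : ℕ) (b₁ b₂ : BasedLoop n m) : Prop :=
  b₂.1.2 = b₁.1.2.rotate k ∧
    b₂.1.1.1 = b₁.1.1.1 + ((cyclicPartialSum k b₁.1.2).1 : ZMod n) ∧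
    b₂.1.1.2 = b₁.1.1.2 + ((cyclicPartialSum k b₁.1.2).2 : ZMod m)

theorem BasedLoop.length_pos {n m : ℕ} (hm : 1 ≤ m) (b : BasedLoop n m) :
    0 < b.1.2.length := by
  have hsum := b.2.2
  refine List.length_pos_of_ne_nil fun h => ?_
  simp [h, Prod.ext_iff] at hsum
  omega

theorem BasedLoop.isIteratedRot_one {n m : ℕ} {b₁ b₂ : BasedLoop n m} (h : LoopRot n m b₁ b₂) :
    b₁.IsIteratedRot 1 b₂ := by
  obtain ⟨v, s₀, L, h₁, h₂⟩ := h
  simp [IsIteratedRot, h₁, h₂, cyclicPartialSum]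

theorem BasedLoop.IsIteratedRot.trans {n m k l : ℕ} {b₁ b₂ b₃ : BasedLoop n m}
    (h : b₁.IsIteratedRot k b₂) (h' : b₂.IsIteratedRot l b₃) : b₁.IsIteratedRot (k + l) b₃ := by
  obtain ⟨hs, hx, hy⟩ := h
  obtain ⟨hs', hx', hy'⟩ := h'
  refine ⟨by rw [hs', hs, List.rotate_rotate], ?_, ?_⟩
  · rw [hx', hx, hs, cyclicPartialSum_add]
    push_cast [Prod.fst_add]
    ring
  · rw [hy', hy, hs, cyclicPartialSum_add]
    push_cast [Prod.snd_add]
    ring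

theorem BasedLoop.cyclicPartialSum_mul_length {n m : ℕ} (b : BasedLoop n m) (k : ℕ) :
    cyclicPartialSum (k * b.1.2.length) b.1.2 = (k * n, k * m) := by
  rw [cyclicPartialSum_mul_of_rotate_eq (List.rotate_length b.1.2), cyclicPartialSum_length,
    b.2.2]
  simp

theorem BasedLoop.IsIteratedRot.symm {n m k : ℕ} (hm : 1 ≤ m) {b₁ b₂ : BasedLoop n m}
    (h : b₁.IsIteratedRot k b₂) : b₂.IsIteratedRot (k * b₁.1.2.length - k) b₁ := by
  obtain ⟨hs, hx, hy⟩ := h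
  have hle : k ≤ k * b₁.1.2.length := Nat.le_mul_of_pos_right k (b₁.length_pos hm)
  have hadd : k + (k * b₁.1.2.length - k) = k * b₁.1.2.length := by omega
  have hsum := b₁.cyclicPartialSum_mul_length k
  rw [← hadd, cyclicPartialSum_add, ← hs, Prod.ext_iff] at hsum
  obtain ⟨hsx, hsy⟩ := hsum
  refine ⟨?_, ?_, ?_⟩
  · rw [hs, List.rotate_rotate, hadd, rotate_mul_of_rotate_eq (List.rotate_length b₁.1.2)]
  · have := congrArg (Nat.cast : ℕ → ZMod n) hsx
    rw [hx, add_assoc, ← Nat.cast_add, ← Prod.fst_add, this]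
    simp
  · have := congrArg (Nat.cast : ℕ → ZMod m) hsy
    rw [hy, add_assoc, ← Nat.cast_add, ← Prod.snd_add, this]
    simp

theorem BasedLoop.exists_isIteratedRot_of_mk_eq {n m : ℕ} (hm : 1 ≤ m) {b₁ b₂ : BasedLoop n m}
    (h : Quot.mk (LoopRot n m) b₁ = Quot.mk (LoopRot n m) b₂) :
    ∃ k, b₁.IsIteratedRot k b₂ := by
  replace h := Quot.eqvGen_exact h
  induction h with
  | rel _ _ h => exact ⟨1, isIteratedRot_one h⟩
  | refl _ => exact ⟨0, by simp [IsIteratedRot, cyclicPartialSum]⟩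
  | symm _ _ _ ih =>
    obtain ⟨k, hk⟩ := ih
    exact ⟨_, hk.symm hm⟩
  | trans _ _ _ _ _ ih ih' =>
    obtain ⟨k, hk⟩ := ih
    obtain ⟨l, hl⟩ := ih'
    exact ⟨_, hk.trans hl⟩

theorem LoopRot.translate {n m : ℕ} {b₁ b₂ : BasedLoop n m} (h : LoopRot n m b₁ b₂)
    (c : ZMod n) (d : ZMod m) : LoopRot n m (b₁.translate c d) (b₂.translate c d) := by
  obtain ⟨v, s₀, L, h₁, h₂⟩ := h
  refine ⟨v + (c, d), s₀, L, ?_, ?_⟩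
  · simp [BasedLoop.translate, h₁, Prod.ext_iff]
  · simp [BasedLoop.translate, h₂, Prod.ext_iff, add_right_comm]

/-- If the periodic word is invariant under a shift by `j` and the height gained during the shift
is a multiple of `m`, then the horizontal displacement is a multiple of `n`. -/
theorem BasedLoop.natCast_cyclicPartialSum_fst_eq_zero {n m j : ℕ} (hm : 1 ≤ m)
    (b : BasedLoop n m) (hrot : b.1.2.rotate j = b.1.2)
    (hy : ((cyclicPartialSum j b.1.2).2 : ZMod m) = 0) :
    ((cyclicPartialSum j b.1.2).1 : ZMod n) = 0 := by
  have hmul := b.cyclicPartialSum_mul_length j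
  rw [Nat.mul_comm, cyclicPartialSum_mul_of_rotate_eq hrot, Prod.ext_iff] at hmul
  simp only [Prod.smul_fst, Prod.smul_snd, smul_eq_mul] at hmul
  obtain ⟨hfst, hsnd⟩ := hmul
  obtain ⟨q, hq⟩ := (ZMod.natCast_eq_zero_iff _ _).1 hy
  have hj : j = b.1.2.length * q := by
    apply Nat.eq_of_mul_eq_mul_right hm
    rw [← hsnd, hq]
    ring
  refine (ZMod.natCast_eq_zero_iff _ _).2 ⟨q, Nat.eq_of_mul_eq_mul_left (b.length_pos hm) ?_⟩
  rw [hfst]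
  nth_rewrite 1 [hj]
  ring

/-- For `n, m ≥ 1`, the action of `ZMod n` on `(n,m)`-Delannoy loops given by
`c • [(v, s)] = [(v + (c, 0), s)]` is well-defined (it descends to the quotient
by the rotation relation) and free (only `c = 0` fixes a loop). -/
theorem zmod_action_on_delannoyLoops_wellDefined_and_free
    (n m : ℕ) (hn : 1 ≤ n) (hm : 1 ≤ m) :
    (∀ (c : ZMod n) (b₁ b₂ : BasedLoop n m), LoopRot n m b₁ b₂ →
        (Quot.mk (LoopRot n m) (b₁.translate c 0) : DelannoyLoop n m) =
          Quot.mk (LoopRot n m) (b₂.translate c 0)) ∧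
    (∀ (c : ZMod n) (b : BasedLoop n m),
        (Quot.mk (LoopRot n m) (b.translate c 0) : DelannoyLoop n m) =
          Quot.mk (LoopRot n m) b → c = 0) := by
  refine ⟨fun c _ _ h => Quot.sound (h.translate c 0), fun c b h => ?_⟩
  obtain ⟨j, hs, hx, hy⟩ := BasedLoop.exists_isIteratedRot_of_mk_eq hm h.symm
  simp only [BasedLoop.translate, add_right_inj] at hs hx hy
  rw [hx]
  exact b.natCast_cyclicPartialSum_fst_eq_zero hm hs.symm hy.symm
end
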